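/- For the scalar Gaussian two-level security wiretap channel with channel gains a, b1, b2 satisfying b1 ≥ b2 ≥ 0 and average power constraint P, the corner rate pair (R1,R2) = ( Cs(P,a,b1), Cs(P,a,b2) − Cs(P,a,b1) ) is achievable; consequently, scalar Gaussian two-level security wiretap channels under an average power constraint are perfectly embeddable (the high-security message is communicated at rate equal to the secrecy capacity Cs(P,a,b1) of the wiretap channel to Z1 while the sum rate equals the secrecy capacity Cs(P,a,b2) of the wiretap channel to Z2). -/

import Mathlib

open MeasureTheory ProbabilityTheory
open scoped BigOperators ENNReal
noncomputable section

/-- Kullback–Leibler divergence (in bits) of `μ` from `ν`. -/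
def klDivBits {Ω : Type*} [MeasurableSpace Ω] (μ ν : Measure Ω) : ℝ :=
  ∫ ω, Real.logb 2 ((μ.rnDeriv ν ω).toReal) ∂μ

/-- Mutual information (in bits) of a joint law on `α × β`: the KL divergence between the
joint law and the product of its marginals. -/
def miBits {α β : Type*} [MeasurableSpace α] [MeasurableSpace β]
    (μ : Measure (α × β)) : ℝ :=
  klDivBits μ ((μ.map Prod.fst).prod (μ.map Prod.snd))

/-- Law of the output of a memoryless Gaussian channel with gain `a` (output
`√a · x + N` with `N` standard Gaussian) on input sequence `xs`. -/
def gaussOut {n : ℕ} (a : ℝ) (xs : Fin n → ℝ) : Measure (Fin n → ℝ) :=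
  Measure.pi fun i => gaussianReal (Real.sqrt a * xs i) 1

/-- Joint law of the (uniform, independent) message pair and the length-`n` output of the
Gaussian channel with gain `a`, for the stochastic encoder `enc`. -/
def jointLaw {n K₁ K₂ : ℕ} (a : ℝ) (enc : Fin K₁ × Fin K₂ → Measure (Fin n → ℝ)) :
    Measure ((Fin K₁ × Fin K₂) × (Fin n → ℝ)) :=
  ((K₁ : ℝ≥0∞) * (K₂ : ℝ≥0∞))⁻¹ •
    Measure.sum fun m : Fin K₁ × Fin K₂ =>
      (Measure.dirac m).prod ((enc m).bind (gaussOut a))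

/-- Achievability of the rate pair `(R₁,R₂)` for the scalar Gaussian two-level security
wiretap channel `Y = √a X + N₁`, `Z₁ = √b₁ X + N₂`, `Z₂ = √b₂ X + N₃` under the average
power constraint `P`: there are codes of blocklength `n` with rates arbitrarily close to
`(R₁,R₂)`, inputs satisfying the power constraint, vanishing decoding error probability,
vanishing normalized leakage `(1/n) I(M₁,M₂;Z₂ⁿ)` and vanishing normalized leakage
`(1/n) I(M₁;Z₁ⁿ)`. -/
def GaussAchievable (a b₁ b₂ P R₁ R₂ : ℝ) : Prop :=
  ∀ ε > 0, ∃ n : ℕ, 0 < n ∧ ∃ K₁ K₂ : ℕ, 0 < K₁ ∧ 0 < K₂ ∧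
    (n : ℝ) * (R₁ - ε) ≤ Real.logb 2 K₁ ∧ (n : ℝ) * (R₂ - ε) ≤ Real.logb 2 K₂ ∧
    ∃ enc : Fin K₁ × Fin K₂ → Measure (Fin n → ℝ),
      (∀ m, IsProbabilityMeasure (enc m)) ∧
      (∀ m, enc m {xs | ∑ i, (xs i) ^ 2 ≤ (n : ℝ) * P} = 1) ∧
      ∃ dec : (Fin n → ℝ) → Fin K₁ × Fin K₂, Measurable dec ∧
        (jointLaw a enc {p | dec p.2 ≠ p.1}).toReal ≤ ε ∧
        miBits (jointLaw b₂ enc) ≤ (n : ℝ) * ε ∧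
        miBits ((jointLaw b₁ enc).map fun p => (p.1.1, p.2)) ≤ (n : ℝ) * ε

/-- The secrecy capacity `Cs(P,a,b)` of the scalar Gaussian wiretap channel. -/
def Cs (P a b : ℝ) : ℝ :=
  max 0 ((1 / 2) * Real.logb 2 (1 + a * P) - (1 / 2) * Real.logb 2 (1 + b * P))


/-- The integral is bounded by the lower integral of its positive part. -/
lemma ofReal_integral_le_lint {Ω : Type*} [MeasurableSpace Ω] {μ : Measure Ω} {f : Ω → ℝ}
    (hf : Integrable f μ) : ENNReal.ofReal (∫ x, f x ∂μ) ≤ ∫⁻ x, ENNReal.ofReal (f x) ∂μ := by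
  have h1 : ∫ x, f x ∂μ ≤ ∫ x, max (f x) 0 ∂μ :=
    integral_mono hf hf.pos_part (fun x => le_max_left _ _)
  refine (ENNReal.ofReal_le_ofReal h1).trans ?_
  rw [ofReal_integral_eq_lintegral_ofReal hf.pos_part (ae_of_all _ fun x => le_max_right _ _)]
  refine lintegral_mono fun x => ?_
  simp [ENNReal.ofReal_max]

/-- Uniform mixture of message-labelled laws. -/
def mixLaw {M Z : Type*} [Fintype M] [MeasurableSpace M] [MeasurableSpace Z]
    (Pm : M → Measure Z) : Measure (M × Z) :=
  (Fintype.card M : ℝ≥0∞)⁻¹ • Measure.sum fun m => (Measure.dirac m).prod (Pm m)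

/-- Uniform law. -/
def unifM (M : Type*) [Fintype M] [MeasurableSpace M] : Measure M :=
  (Fintype.card M : ℝ≥0∞)⁻¹ • Measure.sum fun m => Measure.dirac m

lemma lintegral_unifM {M : Type*} [Fintype M] [MeasurableSpace M] [MeasurableSingletonClass M]
    (f : M → ℝ≥0∞) : ∫⁻ m, f m ∂(unifM M) = (Fintype.card M : ℝ≥0∞)⁻¹ * ∑ m, f m := by
  simp [unifM, lintegral_smul_measure]

instance {M : Type*} [Fintype M] [Nonempty M] [MeasurableSpace M] :
    IsProbabilityMeasure (unifM M) := by
  constructor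
  simp [unifM]
  exact ENNReal.inv_mul_cancel (by simp) (by simp)

lemma integral_unifM {M : Type*} [Fintype M] [MeasurableSpace M] [MeasurableSingletonClass M]
    (f : M → ℝ) : ∫ m, f m ∂(unifM M) = (Fintype.card M : ℝ)⁻¹ * ∑ m, f m := by
  unfold unifM
  rw [integral_smul_measure, Measure.sum_fintype, integral_finsetSum_measure]
  · simp
  · intro i _
    exact integrable_dirac (by simp)

lemma lintegral_mixLaw {M Z : Type*} [Fintype M] [MeasurableSpace M] [MeasurableSpace Z]
    (Pm : M → Measure Z) [∀ m, SFinite (Pm m)] (f : M × Z → ℝ≥0∞) (hf : Measurable f) :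
    ∫⁻ x, f x ∂(mixLaw Pm) = (Fintype.card M : ℝ≥0∞)⁻¹ * ∑ m, ∫⁻ z, f (m, z) ∂(Pm m) := by
  unfold mixLaw
  rw [lintegral_smul_measure, lintegral_sum_measure, tsum_fintype, smul_eq_mul]
  congr 1
  refine Finset.sum_congr rfl fun m _ => ?_
  rw [lintegral_prod _ hf.aemeasurable, lintegral_dirac' _ hf.lintegral_prod_right']

lemma mixLaw_eq {M Z : Type*} [Fintype M] [Nonempty M] [MeasurableSpace M]
    [MeasurableSingletonClass M] [MeasurableSpace Z]
    (R : Measure Z) [IsProbabilityMeasure R] (p : M → Z → ℝ) (hp : ∀ m, Measurable (p m)) :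
    mixLaw (fun m => R.withDensity fun z => ENNReal.ofReal (p m z)) =
      ((unifM M).prod R).withDensity (fun q => ENNReal.ofReal (p q.1 q.2)) := by
  have hpm : Measurable (fun q : M × Z => ENNReal.ofReal (p q.1 q.2)) :=
    (measurable_from_prod_countable_right hp).ennreal_ofReal
  refine Measure.ext_of_lintegral _ fun f hf => ?_
  rw [lintegral_mixLaw _ _ hf, lintegral_withDensity_eq_lintegral_mul _ hpm hf,
    lintegral_prod _ (hpm.mul hf).aemeasurable, lintegral_unifM]
  congr 1
  refine Finset.sum_congr rfl fun m _ => ?_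
  rw [lintegral_withDensity_eq_lintegral_mul _ (hp m).ennreal_ofReal
    (show Measurable fun z => f (m, z) from hf.comp measurable_prodMk_left)]
  rfl

lemma miBits_mix_le {M Z : Type*} [Fintype M] [Nonempty M] [MeasurableSpace M]
    [MeasurableSingletonClass M] [MeasurableSpace Z]
    (R : Measure Z) [IsProbabilityMeasure R] (p : M → Z → ℝ) (hp : ∀ m, Measurable (p m))
    (hpos : ∀ m z, 0 < p m z) (h1 : ∀ m, ∫⁻ z, ENNReal.ofReal (p m z) ∂ R = 1) :
    ENNReal.ofReal (miBits (mixLaw (fun m => R.withDensity fun z => ENNReal.ofReal (p m z)))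
      * Real.log 2) ≤
    1 + (Fintype.card M : ℝ≥0∞)⁻¹ *
      ∑ m, ∫⁻ z, ENNReal.ofReal (p m z * Real.log (1 + p m z)) ∂ R := by
  classical
  set K : ℝ := (Fintype.card M : ℝ) with hK
  have hK0 : 0 < K := by rw [hK]; exact_mod_cast Fintype.card_pos
  set q : Z → ℝ := fun z => K⁻¹ * ∑ m, p m z with hq
  have hqm : Measurable q := (Finset.measurable_sum _ fun m _ => hp m).const_mul _
  have hqpos : ∀ z, 0 < q z := fun z =>
    mul_pos (inv_pos.2 hK0) (Finset.sum_pos (fun m _ => hpos m z) Finset.univ_nonempty)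
  have hpq : ∀ m z, p m z ≤ K * q z := fun m z => by
    simp only [hq]
    rw [mul_inv_cancel_left₀ hK0.ne']
    exact Finset.single_le_sum (f := fun m => p m z) (fun i _ => (hpos i z).le) (Finset.mem_univ m)
  set B := (unifM M).prod R with hB
  have hpm' : Measurable (fun q : M × Z => p q.1 q.2) := measurable_from_prod_countable_right hp
  have hpm : Measurable (fun q : M × Z => ENNReal.ofReal (p q.1 q.2)) := hpm'.ennreal_ofReal
  have hcardinv : ENNReal.ofReal K⁻¹ = (Fintype.card M : ℝ≥0∞)⁻¹ := by
    rw [ENNReal.ofReal_inv_of_pos hK0, hK, ENNReal.ofReal_natCast]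
  have hofq : ∀ z, ENNReal.ofReal (q z) =
      (Fintype.card M : ℝ≥0∞)⁻¹ * ∑ m, ENNReal.ofReal (p m z) := fun z => by
    simp only [hq]
    rw [ENNReal.ofReal_mul (inv_pos.2 hK0).le, hcardinv,
      ENNReal.ofReal_sum_of_nonneg (fun m _ => (hpos m z).le)]
  rw [mixLaw_eq R p hp]
  set μ := B.withDensity (fun q => ENNReal.ofReal (p q.1 q.2)) with hμ
  have hfst : μ.map Prod.fst = unifM M := by
    refine Measure.ext_of_lintegral _ fun f hf => ?_
    rw [lintegral_map hf measurable_fst, hμ, lintegral_withDensity_eq_lintegral_mul _ hpm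
      (show Measurable fun x : M × Z => f x.1 from hf.comp measurable_fst), hB, lintegral_prod _ (hpm.mul (show Measurable fun x : M × Z => f x.1 from
        hf.comp measurable_fst)).aemeasurable]
    refine lintegral_congr fun m => ?_
    simp only [Pi.mul_apply, Function.comp]
    rw [lintegral_mul_const _ (hp m).ennreal_ofReal, h1, one_mul]
  have hsnd : μ.map Prod.snd = R.withDensity (fun z => ENNReal.ofReal (q z)) := by
    refine Measure.ext_of_lintegral _ fun f hf => ?_
    rw [lintegral_map hf measurable_snd, hμ, lintegral_withDensity_eq_lintegral_mul _ hpm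
      (show Measurable fun x : M × Z => f x.2 from hf.comp measurable_snd), hB,
      lintegral_prod_symm _ (hpm.mul (show Measurable fun x : M × Z => f x.2 from
        hf.comp measurable_snd)).aemeasurable,
      lintegral_withDensity_eq_lintegral_mul _ hqm.ennreal_ofReal hf]
    refine lintegral_congr fun z => ?_
    rw [lintegral_unifM]
    simp only [Pi.mul_apply, Function.comp]
    rw [hofq, ← Finset.sum_mul, mul_assoc]
  have hint1 : ∀ m, Integrable (p m) R := fun m => by
    refine ⟨(hp m).aestronglyMeasurable, ?_⟩
    rw [hasFiniteIntegral_iff_ofReal (ae_of_all _ fun z => (hpos m z).le), h1]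
    simp
  have hintq : Integrable q R := (integrable_finsetSum _ fun m _ => hint1 m).const_mul _
  set ν := B.withDensity (fun x => ENNReal.ofReal (q x.2)) with hν
  have hprod : (μ.map Prod.fst).prod (μ.map Prod.snd) = ν := by
    have : SFinite (R.withDensity fun z => ENNReal.ofReal (q z)) := inferInstance
    rw [hfst, hsnd, prod_withDensity_right hqm.ennreal_ofReal]
  have hintq2 : Integrable (fun x : M × Z => q x.2) B := hintq.comp_snd (unifM M)
  have : IsFiniteMeasure ν := by
    refine isFiniteMeasure_withDensity_ofReal hintq2.2
  have hm1 : Measurable (fun x : M × Z => ENNReal.ofReal (q x.2)) :=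
    (hqm.comp measurable_snd).ennreal_ofReal
  have hm2 : Measurable (fun x : M × Z => ENNReal.ofReal (p x.1 x.2 / q x.2)) :=
    (hpm'.div (hqm.comp measurable_snd)).ennreal_ofReal
  have hμν : μ = ν.withDensity (fun x => ENNReal.ofReal (p x.1 x.2 / q x.2)) := by
    rw [hν, ← withDensity_mul _ hm1 hm2, hμ]
    congr 1
    funext x
    simp only [Pi.mul_apply]
    rw [← ENNReal.ofReal_mul (hqpos _).le, mul_div_cancel₀ _ (hqpos _).ne']
  have hrn : μ.rnDeriv ν =ᵐ[μ] fun x => ENNReal.ofReal (p x.1 x.2 / q x.2) := by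
    have hac : μ ≪ ν := by rw [hμν]; exact withDensity_absolutelyContinuous _ _
    refine hac.ae_le ?_
    have := Measure.rnDeriv_withDensity ν hm2
    rwa [← hμν] at this
  set F : M × Z → ℝ := fun x => p x.1 x.2 * Real.log (p x.1 x.2 / q x.2) with hF
  have hFm : Measurable F := hpm'.mul (Real.measurable_log.comp (hpm'.div (hqm.comp measurable_snd)))
  have hmi : miBits μ * Real.log 2 = ∫ x, F x ∂B := by
    unfold miBits klDivBits
    rw [hprod]
    have e1 : ∫ ω, Real.logb 2 ((μ.rnDeriv ν ω).toReal) ∂μ =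
        ∫ x, Real.logb 2 (p x.1 x.2 / q x.2) ∂μ := by
      refine integral_congr_ae ?_
      filter_upwards [hrn] with x hx
      rw [hx, ENNReal.toReal_ofReal (div_nonneg (hpos _ _).le (hqpos _).le)]
    rw [e1, ← integral_mul_const]
    have e2 : ∀ x : M × Z, Real.logb 2 (p x.1 x.2 / q x.2) * Real.log 2 =
        Real.log (p x.1 x.2 / q x.2) := fun x => by
      unfold Real.logb
      rw [div_mul_cancel₀]
      exact (Real.log_pos (by norm_num)).ne'
    simp_rw [e2]
    rw [hμ, integral_withDensity_eq_integral_toReal_smul hpm (ae_of_all _ fun x => by simp)]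
    refine integral_congr_ae (ae_of_all _ fun x => ?_)
    simp only [hF, smul_eq_mul]
    rw [ENNReal.toReal_ofReal (hpos _ _).le]
  have hFint : Integrable F B := by
    have hintp : Integrable (fun x : M × Z => p x.1 x.2) B := by
      refine (hintq2.const_mul K).mono' hpm'.aestronglyMeasurable (ae_of_all _ fun x => ?_)
      rw [Real.norm_eq_abs, abs_of_pos (hpos _ _)]
      exact hpq _ _
    refine Integrable.mono' (g := fun x => p x.1 x.2 * |Real.log K| + (p x.1 x.2 + q x.2))
      ((hintp.mul_const _).add (hintp.add hintq2)) hFm.aestronglyMeasurable (ae_of_all _ fun x => ?_)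
    have ha := hpos x.1 x.2
    have hb := hqpos x.2
    rw [Real.norm_eq_abs, abs_le]
    constructor
    · have : Real.log (q x.2 / p x.1 x.2) ≤ q x.2 / p x.1 x.2 - 1 :=
        Real.log_le_sub_one_of_pos (div_pos hb ha)
      have h3 : Real.log (p x.1 x.2 / q x.2) = - Real.log (q x.2 / p x.1 x.2) := by
        rw [← Real.log_inv, inv_div]
      have h4 : p x.1 x.2 * (q x.2 / p x.1 x.2) = q x.2 := mul_div_cancel₀ _ ha.ne'
      have h5 : 0 ≤ p x.1 x.2 * |Real.log K| := by positivity
      simp only [hF]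
      rw [h3]
      nlinarith [mul_le_mul_of_nonneg_left this ha.le]
    · have : Real.log (p x.1 x.2 / q x.2) ≤ |Real.log K| := by
        refine le_trans (Real.log_le_log (div_pos ha hb) ?_) (le_abs_self _)
        rw [div_le_iff₀ hb]
        exact hpq _ _
      simp only [hF]
      nlinarith [mul_le_mul_of_nonneg_left this ha.le]
  rw [hmi, hB, integral_prod_symm _ hFint]
  refine (ofReal_integral_le_lint hFint.integral_prod_right).trans ?_
  have hpt : ∀ z, ENNReal.ofReal (∫ m, F (m, z) ∂(unifM M)) ≤
      1 + (Fintype.card M : ℝ≥0∞)⁻¹ *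
        ∑ m, ENNReal.ofReal (p m z * Real.log (1 + p m z)) := fun z => by
    rw [integral_unifM]
    have hnn : ∀ m, 0 ≤ p m z * Real.log (1 + p m z) := fun m =>
      mul_nonneg (hpos m z).le (Real.log_nonneg (by linarith [hpos m z]))
    rw [← ENNReal.ofReal_sum_of_nonneg fun m _ => hnn m, ← hcardinv,
      ← ENNReal.ofReal_mul (inv_pos.2 hK0).le, ← ENNReal.ofReal_one,
      ← ENNReal.ofReal_add zero_le_one
        (mul_nonneg (inv_pos.2 hK0).le (Finset.sum_nonneg fun m _ => hnn m))]
    refine ENNReal.ofReal_le_ofReal ?_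
    have hb := hqpos z
    have h6 : ∑ m, F (m, z) ≤ ∑ m, (p m z * Real.log (1 + p m z) + p m z * (- Real.log (q z))) := by
      refine Finset.sum_le_sum fun m _ => ?_
      simp only [hF]
      rw [Real.log_div (hpos m z).ne' hb.ne']
      have : Real.log (p m z) ≤ Real.log (1 + p m z) :=
        Real.log_le_log (hpos m z) (by linarith)
      nlinarith [mul_le_mul_of_nonneg_left this (hpos m z).le]
    rw [Finset.sum_add_distrib, ← Finset.sum_mul] at h6
    have h7 : K⁻¹ * ((∑ m, p m z) * -Real.log (q z)) ≤ 1 := by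
      rw [← mul_assoc]
      change q z * _ ≤ 1
      have : Real.log ((q z)⁻¹) ≤ (q z)⁻¹ - 1 := Real.log_le_sub_one_of_pos (inv_pos.2 hb)
      rw [Real.log_inv] at this
      have h8 : q z * (q z)⁻¹ = 1 := mul_inv_cancel₀ hb.ne'
      nlinarith [mul_le_mul_of_nonneg_left this hb.le]
    have h9 := mul_le_mul_of_nonneg_left h6 (inv_pos.2 hK0).le
    rw [mul_add] at h9
    change K⁻¹ * _ ≤ _
    linarith
  refine (lintegral_mono hpt).trans ?_
  have hmm : ∀ m, Measurable fun z => ENNReal.ofReal (p m z * Real.log (1 + p m z)) := fun m =>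
    ((hp m).mul (Real.measurable_log.comp ((hp m).const_add 1))).ennreal_ofReal
  rw [lintegral_add_left measurable_const, lintegral_const_mul _
    (Finset.measurable_sum _ fun m _ => hmm m), lintegral_finsetSum _ fun m _ => hmm m]
  simp

lemma miBits_subsingleton {M Z : Type*} [Fintype M] [Nonempty M] [Subsingleton M]
    [MeasurableSpace M] [MeasurableSingletonClass M] [MeasurableSpace Z]
    (μ : Measure (M × Z)) [IsProbabilityMeasure μ] : miBits μ = 0 := by
  have hprod : (μ.map Prod.fst).prod (μ.map Prod.snd) = μ := by
    have m0 : M := Classical.arbitrary M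
    have : Unique M := ⟨⟨m0⟩, fun _ => Subsingleton.elim _ _⟩
    have : IsProbabilityMeasure (μ.map Prod.fst) :=
      Measure.isProbabilityMeasure_map measurable_fst.aemeasurable
    have : IsProbabilityMeasure (μ.map Prod.snd) :=
      Measure.isProbabilityMeasure_map measurable_snd.aemeasurable
    have hd : μ.map Prod.fst = Measure.dirac m0 := by
      refine Measure.ext fun s hs => ?_
      rcases Set.eq_empty_or_nonempty s with h | h
      · simp [h]
      · have : s = Set.univ := Subsingleton.eq_univ_of_nonempty h
        simp [this]
    rw [hd]
    refine Measure.ext_of_lintegral _ fun f hf => ?_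
    rw [lintegral_prod _ hf.aemeasurable, lintegral_dirac' _ hf.lintegral_prod_right',
      lintegral_map (show Measurable fun z => f (m0, z) from hf.comp measurable_prodMk_left)
        measurable_snd]
    refine lintegral_congr fun x => ?_
    congr 1
    exact Prod.ext (Subsingleton.elim _ _) rfl
  unfold miBits klDivBits
  rw [hprod]
  have : ∫ ω, Real.logb 2 ((μ.rnDeriv μ ω).toReal) ∂μ = ∫ ω, (0 : ℝ) ∂μ := by
    refine integral_congr_ae ?_
    filter_upwards [Measure.rnDeriv_self μ] with x hx
    rw [hx]; simp
  rw [this]; simp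

lemma lint_eval {J X : Type*} [Fintype J] [MeasurableSpace X] (Q : Measure X)
    [IsProbabilityMeasure Q] (j : J) (f : X → ℝ≥0∞) (hf : Measurable f) :
    ∫⁻ C, f (C j) ∂(Measure.pi fun _ : J => Q) = ∫⁻ x, f x ∂Q :=
  (measurePreserving_eval (fun _ : J => Q) j).lintegral_comp hf

lemma lint_pair {J X : Type*} [Fintype J] [MeasurableSpace X] (Q : Measure X)
    [IsProbabilityMeasure Q] {j j' : J} (hj : j ≠ j') (f : X × X → ℝ≥0∞) (hf : Measurable f) :
    ∫⁻ C, f (C j, C j') ∂(Measure.pi fun _ : J => Q) = ∫⁻ x', ∫⁻ x, f (x, x') ∂Q ∂Q := by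
  have h1 : iIndepFun (fun (i : J) (C : J → X) => C i) (Measure.pi fun _ : J => Q) :=
    iIndepFun_pi (X := fun (_ : J) (x : X) => x) (fun i => aemeasurable_id)
  have h2 := (indepFun_iff_map_prod_eq_prod_map_map (measurable_pi_apply j).aemeasurable
    (measurable_pi_apply j').aemeasurable).1 (h1.indepFun hj)
  rw [(measurePreserving_eval (fun _ : J => Q) j).map_eq,
    (measurePreserving_eval (fun _ : J => Q) j').map_eq] at h2
  rw [← lintegral_prod_symm _ hf.aemeasurable, ← h2, lintegral_map hf
    ((measurable_pi_apply j).prodMk (measurable_pi_apply j'))]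

section abstractcode

variable {J X Z : Type*} [Fintype J] [MeasurableSpace X] [MeasurableSpace Z]

lemma meas_eval {J X Z β : Type*} [MeasurableSpace X] [MeasurableSpace Z] [MeasurableSpace β]
    {w : X → Z → β} (hw : Measurable (Function.uncurry w)) (j : J) :
    Measurable fun q : (J → X) × Z => w (q.1 j) q.2 := by
  have h : Measurable fun q : (J → X) × Z => (q.1 j, q.2) :=
    ((measurable_pi_apply j).comp measurable_fst).prodMk measurable_snd
  exact hw.comp h

lemma pair_bound (Q : Measure X) [IsProbabilityMeasure Q] (R : Measure Z) [IsProbabilityMeasure R]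
    (w : X → Z → ℝ) (hw : Measurable (Function.uncurry w))
    (h1 : ∀ x, ∫⁻ z, ENNReal.ofReal (w x z) ∂ R = 1) (c : ℝ≥0∞)
    (hc : ∀ f : Z → ℝ≥0∞, Measurable f →
      ∫⁻ x, ∫⁻ z, ENNReal.ofReal (w x z) * f z ∂ R ∂Q ≤ c * ∫⁻ z, f z ∂ R)
    {j j' : J} (hj : j ≠ j') :
    ∫⁻ C, ∫⁻ z, ENNReal.ofReal (w (C j) z) * ENNReal.ofReal (w (C j') z) ∂ R
      ∂(Measure.pi fun _ : J => Q) ≤ c := by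
  have hm : Measurable (fun q : (X × X) × Z =>
      ENNReal.ofReal (w q.1.1 q.2) * ENNReal.ofReal (w q.1.2 q.2)) :=
    (hw.comp (measurable_fst.fst.prodMk measurable_snd)).ennreal_ofReal.mul
      (hw.comp (measurable_fst.snd.prodMk measurable_snd)).ennreal_ofReal
  have := lint_pair Q hj (fun q => ∫⁻ z, ENNReal.ofReal (w q.1 z) * ENNReal.ofReal (w q.2 z) ∂ R)
    hm.lintegral_prod_right'
  rw [this]
  calc _ ≤ ∫⁻ x', c ∂Q := by
        refine lintegral_mono fun x' => ?_
        refine (hc _ (hw.comp measurable_prodMk_left).ennreal_ofReal).trans ?_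
        have := h1 x'
        simp only [Function.comp, Function.uncurry]
        rw [this, mul_one]
    _ = c := by simp

lemma leak_point {L : Type*} [Fintype L] [Nonempty L] [DecidableEq L] (v : L → ℝ)
    (hv : ∀ l, 0 < v l) :
    ((Fintype.card L : ℝ)⁻¹ * ∑ l, v l) * Real.log (1 + (Fintype.card L : ℝ)⁻¹ * ∑ l, v l) ≤
    (Fintype.card L : ℝ)⁻¹ * ∑ l, (v l * Real.log (1 + v l / Fintype.card L) +
      (Fintype.card L : ℝ)⁻¹ * ∑ l' ∈ Finset.univ.erase l, v l * v l') := by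
  set K : ℝ := (Fintype.card L : ℝ) with hK
  have hK0 : 0 < K := by rw [hK]; exact_mod_cast Fintype.card_pos
  rw [mul_assoc, Finset.sum_mul]
  refine mul_le_mul_of_nonneg_left (Finset.sum_le_sum fun l _ => ?_) (inv_pos.2 hK0).le
  rw [← Finset.mul_sum, ← Finset.add_sum_erase _ _ (Finset.mem_univ l)]
  set S := ∑ l' ∈ Finset.univ.erase l, v l'
  have hS : 0 ≤ S := Finset.sum_nonneg fun i _ => (hv i).le
  have hu : 0 < v l / K := div_pos (hv l) hK0
  have hS' : 0 ≤ K⁻¹ * S := mul_nonneg (inv_pos.2 hK0).le hS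
  have h3 : 1 + K⁻¹ * (v l + S) ≤ (1 + v l / K) * (1 + K⁻¹ * S) := by
    have : K⁻¹ * v l = v l / K := by rw [div_eq_inv_mul]
    nlinarith [mul_nonneg hu.le hS']
  have h4 : Real.log (1 + K⁻¹ * (v l + S)) ≤ Real.log (1 + v l / K) + K⁻¹ * S := by
    refine (Real.log_le_log (by have := hv l; positivity) h3).trans ?_
    rw [Real.log_mul (by positivity) (by positivity)]
    have := Real.log_le_sub_one_of_pos (show 0 < 1 + K⁻¹ * S by positivity)
    linarith
  calc _ ≤ v l * (Real.log (1 + v l / K) + K⁻¹ * S) := mul_le_mul_of_nonneg_left h4 (hv l).le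
    _ = _ := by ring

lemma leakE (Q : Measure X) [IsProbabilityMeasure Q] (R : Measure Z) [IsProbabilityMeasure R]
    (w : X → Z → ℝ) (hw : Measurable (Function.uncurry w)) (hpos : ∀ x z, 0 < w x z)
    (h1 : ∀ x, ∫⁻ z, ENNReal.ofReal (w x z) ∂ R = 1) (c : ℝ≥0∞)
    (hc : ∀ f : Z → ℝ≥0∞, Measurable f →
      ∫⁻ x, ∫⁻ z, ENNReal.ofReal (w x z) * f z ∂ R ∂Q ≤ c * ∫⁻ z, f z ∂ R)
    {L : Type*} [Fintype L] [Nonempty L] (e : L → J) (he : Function.Injective e) :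
    ∫⁻ C, ∫⁻ z, ENNReal.ofReal (((Fintype.card L : ℝ)⁻¹ * ∑ l, w (C (e l)) z) *
      Real.log (1 + (Fintype.card L : ℝ)⁻¹ * ∑ l, w (C (e l)) z)) ∂ R
      ∂(Measure.pi fun _ : J => Q) ≤
    c + ∫⁻ x, ∫⁻ z, ENNReal.ofReal (w x z * Real.log (1 + w x z / Fintype.card L)) ∂ R ∂Q := by
  classical
  set H := ∫⁻ x, ∫⁻ z, ENNReal.ofReal (w x z * Real.log (1 + w x z / Fintype.card L)) ∂ R ∂Q with hH
  set k : ℝ≥0∞ := (Fintype.card L : ℝ≥0∞)⁻¹ with hk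
  have hK0 : 0 < (Fintype.card L : ℝ) := by exact_mod_cast Fintype.card_pos
  have hk' : ENNReal.ofReal (Fintype.card L : ℝ)⁻¹ = k := by
    rw [ENNReal.ofReal_inv_of_pos hK0, hk, ENNReal.ofReal_natCast]
  have hkk : k * (Fintype.card L : ℝ≥0∞) = 1 := ENNReal.inv_mul_cancel (by simp) (by simp)
  -- measurability
  have hwj : ∀ j : J, Measurable fun q : (J → X) × Z => w (q.1 j) q.2 := fun j =>
    meas_eval hw j
  set A : L → (J → X) → Z → ℝ≥0∞ := fun l C z =>
    ENNReal.ofReal (w (C (e l)) z * Real.log (1 + w (C (e l)) z / Fintype.card L)) with hA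
  set D : L → L → (J → X) → Z → ℝ≥0∞ := fun l l' C z =>
    ENNReal.ofReal (w (C (e l)) z) * ENNReal.ofReal (w (C (e l')) z) with hD
  have hAm : ∀ l, Measurable (Function.uncurry (A l)) := fun l =>
    ((hwj _).mul (Real.measurable_log.comp (((hwj _).div_const _).const_add 1))).ennreal_ofReal
  have hDm : ∀ l l', Measurable (Function.uncurry (D l l')) := fun l l' =>
    (hwj _).ennreal_ofReal.mul (hwj _).ennreal_ofReal
  have hAm1 : ∀ l C, Measurable (A l C) := fun l C => (hAm l).comp measurable_prodMk_left
  have hDm1 : ∀ l l' C, Measurable (D l l' C) := fun l l' C => (hDm l l').comp measurable_prodMk_left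
  have hAm2 : ∀ l, Measurable fun C => ∫⁻ z, A l C z ∂ R := fun l => (hAm l).lintegral_prod_right'
  have hDm2 : ∀ l l', Measurable fun C => ∫⁻ z, D l l' C z ∂ R :=
    fun l l' => (hDm l l').lintegral_prod_right'
  have hpt : ∀ C z, ENNReal.ofReal (((Fintype.card L : ℝ)⁻¹ * ∑ l, w (C (e l)) z) *
      Real.log (1 + (Fintype.card L : ℝ)⁻¹ * ∑ l, w (C (e l)) z)) ≤
      k * ∑ l, (A l C z + k * ∑ l' ∈ Finset.univ.erase l, D l l' C z) := fun C z => by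
    refine (ENNReal.ofReal_le_ofReal (leak_point (fun l => w (C (e l)) z) fun l => hpos _ _)).trans
      (le_of_eq ?_)
    have hnn : ∀ l, 0 ≤ w (C (e l)) z * Real.log (1 + w (C (e l)) z / Fintype.card L) := fun l =>
      mul_nonneg (hpos _ _).le (Real.log_nonneg (by
        have := div_pos (hpos (C (e l)) z) hK0
        linarith))
    have hnn2 : ∀ l, 0 ≤ ∑ l' ∈ Finset.univ.erase l, w (C (e l)) z * w (C (e l')) z := fun l =>
      Finset.sum_nonneg fun l' _ => mul_nonneg (hpos _ _).le (hpos _ _).le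
    rw [ENNReal.ofReal_mul (inv_pos.2 hK0).le, hk', ENNReal.ofReal_sum_of_nonneg fun l _ =>
      add_nonneg (hnn l) (mul_nonneg (inv_pos.2 hK0).le (hnn2 l))]
    congr 1
    refine Finset.sum_congr rfl fun l _ => ?_
    rw [ENNReal.ofReal_add (hnn l) (mul_nonneg (inv_pos.2 hK0).le (hnn2 l)),
      ENNReal.ofReal_mul (inv_pos.2 hK0).le, hk',
      ENNReal.ofReal_sum_of_nonneg fun l' _ => mul_nonneg (hpos _ _).le (hpos _ _).le]
    congr 2
    refine Finset.sum_congr rfl fun l' _ => ?_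
    rw [ENNReal.ofReal_mul (hpos _ _).le]
  refine (lintegral_mono fun C => lintegral_mono (hpt C)).trans ?_
  have e1 : ∀ C, ∫⁻ z, k * ∑ l, (A l C z + k * ∑ l' ∈ Finset.univ.erase l, D l l' C z) ∂ R =
      k * ∑ l, (∫⁻ z, A l C z ∂ R + k * ∑ l' ∈ Finset.univ.erase l, ∫⁻ z, D l l' C z ∂ R) :=
    fun C => by
    have hs : ∀ l, Measurable fun z => ∑ l' ∈ Finset.univ.erase l, D l l' C z := fun l =>
      Finset.measurable_sum _ fun l' _ => hDm1 l l' C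
    have hT : ∀ l, Measurable fun z => A l C z + k * ∑ l' ∈ Finset.univ.erase l, D l l' C z :=
      fun l => (hAm1 l C).add ((hs l).const_mul _)
    rw [lintegral_const_mul _ (Finset.measurable_sum _ fun l _ => hT l),
      lintegral_finsetSum _ fun l _ => hT l]
    congr 1
    refine Finset.sum_congr rfl fun l _ => ?_
    rw [lintegral_add_left (hAm1 l C), lintegral_const_mul _ (hs l),
      lintegral_finsetSum _ fun l' _ => hDm1 l l' C]
  simp_rw [e1]
  have hs : ∀ l, Measurable fun C => ∑ l' ∈ Finset.univ.erase l, ∫⁻ z, D l l' C z ∂ R := fun l =>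
    Finset.measurable_sum _ fun l' _ => hDm2 l l'
  have hT : ∀ l, Measurable fun C => ∫⁻ z, A l C z ∂ R +
      k * ∑ l' ∈ Finset.univ.erase l, ∫⁻ z, D l l' C z ∂ R :=
    fun l => (hAm2 l).add ((hs l).const_mul _)
  rw [lintegral_const_mul _ (Finset.measurable_sum _ fun l _ => hT l),
    lintegral_finsetSum _ fun l _ => hT l]
  have hle : ∀ l ∈ (Finset.univ : Finset L),
      ∫⁻ C, (∫⁻ z, A l C z ∂ R + k * ∑ l' ∈ Finset.univ.erase l, ∫⁻ z, D l l' C z ∂ R)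
        ∂(Measure.pi fun _ : J => Q) ≤ H + c := fun l _ => by
    rw [lintegral_add_left (hAm2 l), lintegral_const_mul _ (hs l),
      lintegral_finsetSum _ fun l' _ => hDm2 l l']
    refine add_le_add (le_of_eq ?_) ?_
    · have hm : Measurable (Function.uncurry fun x z =>
          ENNReal.ofReal (w x z * Real.log (1 + w x z / Fintype.card L))) :=
        (hw.mul (Real.measurable_log.comp ((hw.div_const _).const_add 1))).ennreal_ofReal
      exact lint_eval Q (e l) (fun x => ∫⁻ z, ENNReal.ofReal (w x z *
        Real.log (1 + w x z / Fintype.card L)) ∂ R) hm.lintegral_prod_right'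
    · calc k * ∑ l' ∈ Finset.univ.erase l, ∫⁻ C, ∫⁻ z, D l l' C z ∂ R ∂(Measure.pi fun _ : J => Q)
          ≤ k * ∑ l' ∈ Finset.univ.erase l, c := by
            gcongr with l' hl'
            exact pair_bound Q R w hw h1 c hc (fun h => (Finset.mem_erase.1 hl').1 (he h).symm)
        _ ≤ k * ∑ l' : L, c := by
            gcongr
            exact Finset.erase_subset _ _
        _ = c := by
            rw [Finset.sum_const, Finset.card_univ, nsmul_eq_mul, ← mul_assoc, hkk, one_mul]
  calc _ ≤ k * ∑ l : L, (H + c) := by gcongr with l hl; exact hle l hl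
    _ = c + H := by
      rw [Finset.sum_const, Finset.card_univ, nsmul_eq_mul, ← mul_assoc, hkk, one_mul, add_comm]

/-- The averaged union bound on the decoding error of the threshold decoder. -/
def errB [DecidableEq J] (R : Measure Z) (w : X → Z → ℝ) (g : X → Z → ℝ≥0∞) (γ : ℝ)
    (C : J → X) : ℝ≥0∞ :=
  (Fintype.card J : ℝ≥0∞)⁻¹ * ∑ j, ∫⁻ z, ENNReal.ofReal (w (C j) z) *
    (g (C j) z + ∑ j' ∈ Finset.univ.erase j, ENNReal.ofReal γ⁻¹ * ENNReal.ofReal (w (C j') z)) ∂ R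

lemma errB_eq [DecidableEq J] (R : Measure Z)
    (w : X → Z → ℝ) (hw : Measurable (Function.uncurry w))
    (g : X → Z → ℝ≥0∞) (hg : Measurable (Function.uncurry g)) (γ : ℝ) (C : J → X) :
    errB R w g γ C = (Fintype.card J : ℝ≥0∞)⁻¹ * ∑ j,
      (∫⁻ z, ENNReal.ofReal (w (C j) z) * g (C j) z ∂ R +
        ENNReal.ofReal γ⁻¹ * ∑ j' ∈ Finset.univ.erase j,
          ∫⁻ z, ENNReal.ofReal (w (C j) z) * ENNReal.ofReal (w (C j') z) ∂ R) := by
  have hwx : ∀ x, Measurable fun z => ENNReal.ofReal (w x z) := fun x =>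
    (hw.comp measurable_prodMk_left).ennreal_ofReal
  have hgx : ∀ x, Measurable (g x) := fun x => hg.comp measurable_prodMk_left
  unfold errB
  congr 1
  refine Finset.sum_congr rfl fun j _ => ?_
  simp_rw [mul_add]
  rw [lintegral_add_left (show Measurable fun z => ENNReal.ofReal (w (C j) z) * g (C j) z from
    (hwx _).mul (hgx _))]
  congr 1
  have : ∀ z, ENNReal.ofReal (w (C j) z) * ∑ j' ∈ Finset.univ.erase j,
      ENNReal.ofReal γ⁻¹ * ENNReal.ofReal (w (C j') z) =
      ENNReal.ofReal γ⁻¹ * ∑ j' ∈ Finset.univ.erase j,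
        ENNReal.ofReal (w (C j) z) * ENNReal.ofReal (w (C j') z) := fun z => by
    rw [← Finset.mul_sum, ← Finset.mul_sum, mul_left_comm]
  simp_rw [this]
  have hT : ∀ j', Measurable fun z => ENNReal.ofReal (w (C j) z) * ENNReal.ofReal (w (C j') z) :=
    fun j' => (hwx _).mul (hwx _)
  rw [lintegral_const_mul _ (Finset.measurable_sum _ fun j' _ => hT j'),
    lintegral_finsetSum _ fun j' _ => hT j']

lemma errB_meas [DecidableEq J] (R : Measure Z) [IsProbabilityMeasure R]
    (w : X → Z → ℝ) (hw : Measurable (Function.uncurry w))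
    (g : X → Z → ℝ≥0∞) (hg : Measurable (Function.uncurry g)) (γ : ℝ) :
    Measurable (errB (J := J) R w g γ) := by
  have hwj : ∀ j : J, Measurable fun q : (J → X) × Z => w (q.1 j) q.2 := fun j =>
    meas_eval hw j
  have hgj : ∀ j : J, Measurable fun q : (J → X) × Z => g (q.1 j) q.2 := fun j =>
    meas_eval hg j
  unfold errB
  refine Measurable.const_mul (Finset.measurable_sum _ fun j _ => ?_) _
  refine Measurable.lintegral_prod_right' (f := fun q : (J → X) × Z =>
    ENNReal.ofReal (w (q.1 j) q.2) *
    (g (q.1 j) q.2 + ∑ j' ∈ Finset.univ.erase j, ENNReal.ofReal γ⁻¹ *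
      ENNReal.ofReal (w (q.1 j') q.2))) ?_
  exact (hwj j).ennreal_ofReal.mul ((hgj j).add (Finset.measurable_sum _ fun j' _ =>
    (hwj j').ennreal_ofReal.const_mul _))

lemma errE [Nonempty J] [DecidableEq J]
    (Q : Measure X) [IsProbabilityMeasure Q] (R : Measure Z) [IsProbabilityMeasure R]
    (w : X → Z → ℝ) (hw : Measurable (Function.uncurry w))
    (h1 : ∀ x, ∫⁻ z, ENNReal.ofReal (w x z) ∂ R = 1) (c : ℝ≥0∞)
    (hc : ∀ f : Z → ℝ≥0∞, Measurable f →
      ∫⁻ x, ∫⁻ z, ENNReal.ofReal (w x z) * f z ∂ R ∂Q ≤ c * ∫⁻ z, f z ∂ R)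
    (g : X → Z → ℝ≥0∞) (hg : Measurable (Function.uncurry g)) (γ : ℝ) :
    ∫⁻ C, errB R w g γ C ∂(Measure.pi fun _ : J => Q) ≤
      ∫⁻ x, ∫⁻ z, ENNReal.ofReal (w x z) * g x z ∂ R ∂Q +
        ENNReal.ofReal γ⁻¹ * ((Fintype.card J : ℝ≥0∞) * c) := by
  simp_rw [errB_eq R w hw g hg γ]
  set k : ℝ≥0∞ := (Fintype.card J : ℝ≥0∞)⁻¹ with hk
  have hkk : k * (Fintype.card J : ℝ≥0∞) = 1 := ENNReal.inv_mul_cancel (by simp) (by simp)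
  have hwj : ∀ j : J, Measurable fun q : (J → X) × Z => w (q.1 j) q.2 := fun j =>
    meas_eval hw j
  have hgj : ∀ j : J, Measurable fun q : (J → X) × Z => g (q.1 j) q.2 := fun j =>
    meas_eval hg j
  have hA : ∀ j : J, Measurable fun C : J → X =>
      ∫⁻ z, ENNReal.ofReal (w (C j) z) * g (C j) z ∂ R := fun j =>
    ((hwj j).ennreal_ofReal.mul (hgj j)).lintegral_prod_right'
  have hD : ∀ j j' : J, Measurable fun C : J → X =>
      ∫⁻ z, ENNReal.ofReal (w (C j) z) * ENNReal.ofReal (w (C j') z) ∂ R := fun j j' =>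
    ((hwj j).ennreal_ofReal.mul (hwj j').ennreal_ofReal).lintegral_prod_right'
  have hS : ∀ j : J, Measurable fun C : J → X => ∑ j' ∈ Finset.univ.erase j,
      ∫⁻ z, ENNReal.ofReal (w (C j) z) * ENNReal.ofReal (w (C j') z) ∂ R := fun j =>
    Finset.measurable_sum _ fun j' _ => hD j j'
  have hAS : ∀ j : J, Measurable fun C : J → X =>
      ∫⁻ z, ENNReal.ofReal (w (C j) z) * g (C j) z ∂ R + ENNReal.ofReal γ⁻¹ *
        ∑ j' ∈ Finset.univ.erase j,
          ∫⁻ z, ENNReal.ofReal (w (C j) z) * ENNReal.ofReal (w (C j') z) ∂ R := fun j =>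
    (hA j).add ((hS j).const_mul _)
  rw [lintegral_const_mul _ (Finset.measurable_sum _ fun l _ => hAS l),
    lintegral_finsetSum _ fun l _ => hAS l]
  set T := ∫⁻ x, ∫⁻ z, ENNReal.ofReal (w x z) * g x z ∂ R ∂Q +
        ENNReal.ofReal γ⁻¹ * ((Fintype.card J : ℝ≥0∞) * c) with hT
  have hle : ∀ j ∈ (Finset.univ : Finset J), ∫⁻ C, (∫⁻ z, ENNReal.ofReal (w (C j) z) * g (C j) z ∂ R +
        ENNReal.ofReal γ⁻¹ * ∑ j' ∈ Finset.univ.erase j,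
          ∫⁻ z, ENNReal.ofReal (w (C j) z) * ENNReal.ofReal (w (C j') z) ∂ R)
        ∂(Measure.pi fun _ : J => Q) ≤ T := fun j _ => by
    rw [lintegral_add_left (hA j), lintegral_const_mul _ (hS j),
      lintegral_finsetSum _ fun l' _ => hD j l']
    refine add_le_add (le_of_eq ?_) ?_
    · exact lint_eval Q j (fun x => ∫⁻ z, ENNReal.ofReal (w x z) * g x z ∂ R)
        (hw.ennreal_ofReal.mul hg).lintegral_prod_right'
    · gcongr
      calc _ ≤ ∑ j' ∈ Finset.univ.erase j, c := by
            gcongr with j' hj'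
            exact pair_bound Q R w hw h1 c hc (fun h => (Finset.mem_erase.1 hj').1 h.symm)
        _ ≤ ∑ j' : J, c := by
            gcongr
            exact Finset.erase_subset _ _
        _ = _ := by rw [Finset.sum_const, Finset.card_univ, nsmul_eq_mul]
  calc _ ≤ k * ∑ l : J, T := by gcongr with l hl; exact hle l hl
    _ = T := by
      rw [Finset.sum_const, Finset.card_univ, nsmul_eq_mul, ← mul_assoc, hkk, one_mul]

lemma exists_decoder [Nonempty J] [DecidableEq J] [MeasurableSpace J]
    (w : X → Z → ℝ) (hw : Measurable (Function.uncurry w))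
    (g : X → Z → ℝ≥0∞) (γ : ℝ) (hγ : 0 < γ) (hg : ∀ x z, w x z ≤ γ → 1 ≤ g x z) (C : J → X) :
    ∃ D : Z → J, Measurable D ∧ ∀ j z, D z ≠ j →
      1 ≤ g (C j) z + ∑ j' ∈ Finset.univ.erase j, ENNReal.ofReal γ⁻¹ * ENNReal.ofReal (w (C j') z) := by
  classical
  set G : (J → Prop) → J := fun S => if h : ∃ j, S j ∧ ∀ j', j' ≠ j → ¬ S j' then h.choose
    else Classical.arbitrary J with hG
  have hGm : Measurable G := measurable_of_finite G
  refine ⟨fun z => G fun j => γ < w (C j) z, hGm.comp (measurable_pi_iff.2 fun j =>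
    measurableSet_setOfPred.1 (measurableSet_lt measurable_const (hw.comp measurable_prodMk_left))), ?_⟩
  intro j z hne
  by_cases h : w (C j) z ≤ γ
  · exact (hg _ _ h).trans (self_le_add_right _ _)
  · push Not at h
    by_cases h2 : ∃ j', j' ≠ j ∧ γ < w (C j') z
    · obtain ⟨j', hj', hw'⟩ := h2
      refine le_trans ?_ (self_le_add_left _ _)
      refine le_trans ?_ (Finset.single_le_sum (fun _ _ => zero_le)
        (Finset.mem_erase.2 ⟨hj', Finset.mem_univ _⟩))
      rw [← ENNReal.ofReal_mul (inv_pos.2 hγ).le, ← ENNReal.ofReal_one]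
      refine ENNReal.ofReal_le_ofReal ?_
      rw [inv_mul_eq_div, le_div_iff₀ hγ]
      linarith
    · exfalso
      push Not at h2
      apply hne
      have hex : ∃ j, (γ < w (C j) z) ∧ ∀ j', j' ≠ j → ¬ (γ < w (C j') z) :=
        ⟨j, h, fun j' hj' => not_lt.2 (h2 j' hj')⟩
      have e : G (fun j => γ < w (C j) z) = hex.choose := dif_pos hex
      change G (fun j => γ < w (C j) z) = j
      rw [e]
      by_contra hcon
      exact absurd hex.choose_spec.1 (not_lt.2 (h2 _ hcon))

end abstractcode

/-! ### Gaussian computations -/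

open scoped NNReal

def sv (b : ℝ) (v : ℝ≥0) : ℝ≥0 := 1 + b.toNNReal * v

lemma sv_coe (b : ℝ) (hb : 0 ≤ b) (v : ℝ≥0) : (sv b v : ℝ) = 1 + b * v := by
  simp [sv, hb]

lemma sv_pos (b : ℝ) (v : ℝ≥0) : 0 < sv b v := by
  unfold sv; positivity

lemma sv_pos_real (b : ℝ) (v : ℝ≥0) : (0:ℝ) < sv b v := by
  exact_mod_cast sv_pos b v

def wdE (b : ℝ) (v : ℝ≥0) (x z : ℝ) : ℝ :=
  1/2 * Real.log (sv b v) - (z - Real.sqrt b * x)^2/2 + z^2/(2 * (sv b v : ℝ))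

def wd {n : ℕ} (b : ℝ) (v : ℝ≥0) (x z : Fin n → ℝ) : ℝ :=
  Real.exp (∑ i, wdE b v (x i) (z i))

def outR (n : ℕ) (b : ℝ) (v : ℝ≥0) : Measure (Fin n → ℝ) :=
  Measure.pi fun _ => gaussianReal 0 (sv b v)

instance (n : ℕ) (b : ℝ) (v : ℝ≥0) : IsProbabilityMeasure (outR n b v) := by
  unfold outR; infer_instance

instance {n : ℕ} (b : ℝ) (x : Fin n → ℝ) : IsProbabilityMeasure (gaussOut b x) := by
  unfold gaussOut; infer_instance

lemma wdE_meas (b : ℝ) (v : ℝ≥0) : Measurable (Function.uncurry (wdE b v)) := by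
  unfold wdE Function.uncurry; fun_prop

lemma wd_meas {n : ℕ} (b : ℝ) (v : ℝ≥0) :
    Measurable (Function.uncurry (wd (n := n) b v)) := by
  unfold wd wdE Function.uncurry; fun_prop

lemma wd_pos {n : ℕ} (b : ℝ) (v : ℝ≥0) (x z : Fin n → ℝ) : 0 < wd b v x z := Real.exp_pos _

lemma gauss1_density (b : ℝ) (v : ℝ≥0) (x : ℝ) :
    gaussianReal (Real.sqrt b * x) 1 =
      (gaussianReal 0 (sv b v)).withDensity fun z => ENNReal.ofReal (Real.exp (wdE b v x z)) := by
  have hs := sv_pos_real b v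
  have hm : Measurable fun z => ENNReal.ofReal (Real.exp (wdE b v x z)) := by
    unfold wdE; fun_prop
  rw [gaussianReal_of_var_ne_zero _ one_ne_zero, gaussianReal_of_var_ne_zero _ (sv_pos b v).ne',
    ← withDensity_mul _ (measurable_gaussianPDF _ _) hm]
  congr 1
  ext z
  simp only [Pi.mul_apply, gaussianPDF]
  rw [← ENNReal.ofReal_mul (gaussianPDFReal_nonneg _ _ _)]
  congr 1
  unfold gaussianPDFReal wdE
  have h1 : Real.exp (1/2 * Real.log (sv b v)) = Real.sqrt (sv b v) := by
    rw [Real.sqrt_eq_rpow, Real.rpow_def_of_pos hs]; ring_nf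
  rw [show 1/2 * Real.log (sv b v) - (z - Real.sqrt b * x)^2/2 + z^2/(2 * (sv b v : ℝ))
    = 1/2 * Real.log (sv b v) + (- (z - Real.sqrt b * x)^2/(2 * ((1:ℝ≥0):ℝ)))
      + z^2/(2 * (sv b v : ℝ)) by push_cast; ring, Real.exp_add, Real.exp_add, h1,
    Real.sqrt_mul (by positivity), Real.sqrt_mul (by positivity)]
  have h2 : Real.exp (-(z - 0)^2 / (2 * (sv b v : ℝ))) * Real.exp (z^2/(2 * (sv b v : ℝ))) = 1 := by
    rw [← Real.exp_add]; simp; ring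
  have h3 : Real.sqrt (sv b v) ≠ 0 := by positivity
  generalize Real.exp (-(z - 0)^2 / (2 * (sv b v : ℝ))) = A at *
  generalize Real.exp (z^2/(2 * (sv b v : ℝ))) = B at *
  generalize Real.exp _ = D
  have h4 : Real.sqrt 2 * Real.sqrt Real.pi ≠ 0 := by positivity
  simp only [NNReal.coe_one, Real.sqrt_one, mul_one]
  have h5 : (Real.sqrt 2 * Real.sqrt Real.pi * Real.sqrt (sv b v))⁻¹ * A * (Real.sqrt (sv b v) * D * B)
    = (Real.sqrt 2 * Real.sqrt Real.pi)⁻¹ * D * (A * B) := by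
    field_simp
  rw [Real.sqrt_mul (by positivity), Real.sqrt_mul (by positivity), h5, h2, mul_one]

lemma lint_prod_pi {n : ℕ} (μ : Fin n → Measure ℝ) [∀ i, IsProbabilityMeasure (μ i)]
    (f : Fin n → ℝ → ℝ≥0∞) (hf : ∀ i, Measurable (f i)) :
    ∫⁻ z, ∏ i, f i (z i) ∂(Measure.pi μ) = ∏ i, ∫⁻ z, f i z ∂(μ i) := by
  rw [lintegral_prod_eq_prod_lintegral_of_indepFun Finset.univ (fun i (z : Fin n → ℝ) => f i (z i))
    (iIndepFun_pi (X := f) fun i => (hf i).aemeasurable) (fun i => by have := hf i; fun_prop)]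
  refine Finset.prod_congr rfl fun i _ => ?_
  exact (measurePreserving_eval μ i).lintegral_comp (hf i)

lemma gaussOut_density {n : ℕ} (b : ℝ) (v : ℝ≥0) (x : Fin n → ℝ) :
    gaussOut b x = (outR n b v).withDensity fun z => ENNReal.ofReal (wd b v x z) := by
  unfold gaussOut
  refine Measure.pi_eq fun s hs => ?_
  rw [withDensity_apply _ (MeasurableSet.univ_pi hs), ← lintegral_indicator (MeasurableSet.univ_pi hs)]
  have hm : ∀ i, Measurable fun z => ENNReal.ofReal (Real.exp (wdE b v (x i) z)) := by
    intro i; unfold wdE; fun_prop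
  have h : ∀ z : Fin n → ℝ, (Set.univ.pi s).indicator (fun z => ENNReal.ofReal (wd b v x z)) z
      = ∏ i, (s i).indicator (fun z => ENNReal.ofReal (Real.exp (wdE b v (x i) z))) (z i) := by
    intro z
    by_cases hz : z ∈ Set.univ.pi s
    · rw [Set.indicator_of_mem hz]
      unfold wd
      rw [Real.exp_sum, ENNReal.ofReal_prod_of_nonneg (fun _ _ => (Real.exp_pos _).le)]
      refine Finset.prod_congr rfl fun i _ => ?_
      rw [Set.indicator_of_mem (hz i trivial)]
    · rw [Set.indicator_of_notMem hz]
      rw [Set.mem_univ_pi] at hz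
      push Not at hz
      obtain ⟨i, hi⟩ := hz
      exact (Finset.prod_eq_zero (Finset.mem_univ i) (Set.indicator_of_notMem hi _)).symm
  simp_rw [h]
  unfold outR
  rw [lint_prod_pi _ (fun i => (s i).indicator fun z => ENNReal.ofReal (Real.exp (wdE b v (x i) z)))
    (fun i => (hm i).indicator (hs i))]
  refine Finset.prod_congr rfl fun i _ => ?_
  rw [lintegral_indicator (hs i), gauss1_density b v (x i), withDensity_apply _ (hs i)]

lemma wd_one {n : ℕ} (b : ℝ) (v : ℝ≥0) (x : Fin n → ℝ) :
    ∫⁻ z, ENNReal.ofReal (wd b v x z) ∂(outR n b v) = 1 := by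
  have h := measure_univ (μ := gaussOut b x)
  rwa [gaussOut_density b v x, withDensity_apply _ MeasurableSet.univ, setLIntegral_univ] at h

lemma lint_gaussOut {n : ℕ} (b : ℝ) (v : ℝ≥0) (x : Fin n → ℝ) (f : (Fin n → ℝ) → ℝ≥0∞)
    (hf : Measurable f) :
    ∫⁻ z, f z ∂(gaussOut b x) = ∫⁻ z, ENNReal.ofReal (wd b v x z) * f z ∂(outR n b v) := by
  have hm : Measurable fun z => ENNReal.ofReal (wd b v x z) :=
    ((wd_meas b v).comp measurable_prodMk_left).ennreal_ofReal
  rw [gaussOut_density b v x, lintegral_withDensity_eq_lintegral_mul _ hm hf]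
  rfl

lemma gaussOut_meas {n : ℕ} (b : ℝ) : Measurable (gaussOut (n := n) b) := by
  refine Measure.measurable_of_measurable_coe _ fun s hs => ?_
  have h : ∀ x : Fin n → ℝ, gaussOut b x s = ∫⁻ z in s, ENNReal.ofReal (wd b 0 x z) ∂(outR n b 0) := by
    intro x
    rw [gaussOut_density b 0 x, withDensity_apply _ hs]
  simp_rw [h]
  exact Measurable.lintegral_prod_right' (f := fun p : (Fin n → ℝ) × (Fin n → ℝ) =>
    ENNReal.ofReal (wd b 0 p.1 p.2)) (wd_meas b 0).ennreal_ofReal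

lemma gaussOut_map {n : ℕ} (b : ℝ) (x : Fin n → ℝ) :
    gaussOut b x = (Measure.pi fun _ : Fin n => gaussianReal 0 1).map
      fun u i => Real.sqrt b * x i + u i := by
  have := Measure.pi_map_pi (μ := fun _ : Fin n => gaussianReal 0 1)
    (f := fun i u => Real.sqrt b * x i + u)
    (hμ := fun i => by rw [gaussianReal_map_const_add]; infer_instance)
    (fun i => by fun_prop)
  rw [this]
  unfold gaussOut
  simp_rw [gaussianReal_map_const_add, zero_add]

lemma joint_lint {n : ℕ} (b : ℝ) (v : ℝ≥0) (H : (Fin n → ℝ) → (Fin n → ℝ) → ℝ≥0∞)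
    (hH : Measurable (Function.uncurry H)) :
    ∫⁻ x, ∫⁻ z, H x z ∂(gaussOut b x) ∂(Measure.pi fun _ : Fin n => gaussianReal 0 v)
      = ∫⁻ ω, H (fun i => (ω i).1) (fun i => Real.sqrt b * (ω i).1 + (ω i).2)
        ∂(Measure.pi fun _ : Fin n => (gaussianReal 0 v).prod (gaussianReal 0 1)) := by
  have h1 : ∀ x : Fin n → ℝ, ∫⁻ z, H x z ∂(gaussOut b x)
      = ∫⁻ u, H x (fun i => Real.sqrt b * x i + u i) ∂(Measure.pi fun _ : Fin n => gaussianReal 0 1) := by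
    intro x
    have hm : Measurable (fun z => H x z) := hH.comp measurable_prodMk_left
    have hm2 : Measurable fun (u : Fin n → ℝ) i => Real.sqrt b * x i + u i := by fun_prop
    rw [gaussOut_map, lintegral_map hm hm2]
  simp_rw [h1]
  have hm : Measurable fun p : (Fin n → ℝ) × (Fin n → ℝ) =>
      H p.1 (fun i => Real.sqrt b * p.1 i + p.2 i) := by
    exact hH.comp (by fun_prop : Measurable fun p : (Fin n → ℝ) × (Fin n → ℝ) =>
      (p.1, fun i => Real.sqrt b * p.1 i + p.2 i))
  rw [← lintegral_prod (fun p : (Fin n → ℝ) × (Fin n → ℝ) =>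
      H p.1 (fun i => Real.sqrt b * p.1 i + p.2 i)) hm.aemeasurable,
    ← (measurePreserving_arrowProdEquivProdArrow ℝ ℝ (Fin n) (fun _ => gaussianReal 0 v)
      (fun _ => gaussianReal 0 1)).lintegral_comp hm]
  rfl

lemma map_sum_gauss (b : ℝ) (hb : 0 ≤ b) (v : ℝ≥0) :
    ((gaussianReal 0 v).prod (gaussianReal 0 1)).map (fun p : ℝ × ℝ => Real.sqrt b * p.1 + p.2)
      = gaussianReal 0 (sv b v) := by
  have hX : ((gaussianReal 0 v).prod (gaussianReal 0 1)).map (fun p : ℝ × ℝ => Real.sqrt b * p.1)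
      = gaussianReal (Real.sqrt b * 0) (.mk (Real.sqrt b ^ 2) (sq_nonneg _) * v) := by
    rw [← gaussianReal_map_const_mul, ← Measure.fst_prod (μ := gaussianReal 0 v) (ν := gaussianReal 0 1),
      Measure.fst, Measure.map_map (by fun_prop) (by fun_prop)]
    simp
    rfl
  have hY : ((gaussianReal 0 v).prod (gaussianReal 0 1)).map (fun p : ℝ × ℝ => p.2)
      = gaussianReal 0 1 := by
    have := Measure.snd_prod (μ := gaussianReal 0 v) (ν := gaussianReal 0 1)
    exact this
  have hI : IndepFun (fun p : ℝ × ℝ => Real.sqrt b * p.1) (fun p : ℝ × ℝ => p.2)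
      ((gaussianReal 0 v).prod (gaussianReal 0 1)) :=
    indepFun_prod (X := fun x : ℝ => Real.sqrt b * x) (Y := fun y : ℝ => y)
      (by fun_prop) (by fun_prop)
  have := gaussianReal_add_gaussianReal_of_indepFun hI hX hY
  rw [show (fun p : ℝ × ℝ => Real.sqrt b * p.1 + p.2) =
    (fun p : ℝ × ℝ => Real.sqrt b * p.1) + (fun p : ℝ × ℝ => p.2) from rfl, this]
  congr 1
  · simp
  · ext
    rw [sv_coe b hb]
    simp [Real.sq_sqrt hb]
    ring

lemma out_marg {n : ℕ} (b : ℝ) (hb : 0 ≤ b) (v : ℝ≥0) (f : (Fin n → ℝ) → ℝ≥0∞) (hf : Measurable f) :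
    ∫⁻ x, ∫⁻ z, f z ∂(gaussOut b x) ∂(Measure.pi fun _ : Fin n => gaussianReal 0 v)
      = ∫⁻ z, f z ∂(outR n b v) := by
  rw [joint_lint b v (fun _ z => f z) (hf.comp measurable_snd)]
  unfold outR
  have := Measure.pi_map_pi (μ := fun _ : Fin n => (gaussianReal 0 v).prod (gaussianReal 0 1))
    (f := fun i p => Real.sqrt b * p.1 + p.2)
    (hμ := fun i => by rw [map_sum_gauss b hb]; infer_instance)
    (fun i => by fun_prop)
  simp_rw [map_sum_gauss b hb] at this
  rw [← this, lintegral_map hf (by fun_prop)]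

def Tf (b : ℝ) (v : ℝ≥0) (p : ℝ × ℝ) : ℝ :=
  (Real.sqrt b * p.1 + p.2)^2/(2 * (sv b v : ℝ)) - p.2^2/2

lemma memLp_sq_of_four {Ω : Type*} [MeasurableSpace Ω] (μ : Measure Ω) (f : Ω → ℝ)
    (hf : MemLp f 4 μ) : MemLp (fun x => f x ^ 2) 2 μ := by
  have : ENNReal.HolderTriple 4 4 2 := ⟨by
    rw [show (4:ℝ≥0∞) = 2 * 2 by norm_num, ENNReal.mul_inv (by simp) (by simp), ← mul_add,
      ENNReal.inv_two_add_inv_two, mul_one]⟩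
  have h := MemLp.mul (p := 4) (q := 4) (r := 2) hf hf
  refine h.congr_norm (hf.1.pow 2) ?_
  filter_upwards with x
  simp [pow_two]

lemma Tf_memLp (b : ℝ) (v : ℝ≥0) :
    MemLp (Tf b v) 2 ((gaussianReal 0 v).prod (gaussianReal 0 1)) := by
  have h1 : MemLp (fun p : ℝ × ℝ => p.1) 4 ((gaussianReal 0 v).prod (gaussianReal 0 1)) :=
    (memLp_id_gaussianReal' (μ := 0) (v := v) 4 (by simp)).comp_fst _
  have h2 : MemLp (fun p : ℝ × ℝ => p.2) 4 ((gaussianReal 0 v).prod (gaussianReal 0 1)) :=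
    (memLp_id_gaussianReal' (μ := 0) (v := 1) 4 (by simp)).comp_snd _
  have h3 := memLp_sq_of_four _ _ ((h1.const_mul (Real.sqrt b)).add h2)
  have h4 := memLp_sq_of_four _ _ h2
  have := (h3.const_mul ((2 * (sv b v : ℝ))⁻¹)).sub (h4.const_mul (2⁻¹))
  refine this.congr_norm (this.1.congr ?_) ?_ <;> filter_upwards with p <;>
    simp [Tf, div_eq_inv_mul]

lemma gauss_sq_int (v : ℝ≥0) : ∫ x, x^2 ∂(gaussianReal 0 v) = v := by
  have := variance_fun_id_gaussianReal (μ := 0) (v := v)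
  rwa [variance_of_integral_eq_zero (by fun_prop) (by simp)] at this

lemma Tf_mean (b : ℝ) (hb : 0 ≤ b) (v : ℝ≥0) :
    ∫ p, Tf b v p ∂((gaussianReal 0 v).prod (gaussianReal 0 1)) = 0 := by
  have h1 : MemLp (fun p : ℝ × ℝ => p.1) 4 ((gaussianReal 0 v).prod (gaussianReal 0 1)) :=
    (memLp_id_gaussianReal' (μ := 0) (v := v) 4 (by simp)).comp_fst _
  have h2 : MemLp (fun p : ℝ × ℝ => p.2) 4 ((gaussianReal 0 v).prod (gaussianReal 0 1)) :=
    (memLp_id_gaussianReal' (μ := 0) (v := 1) 4 (by simp)).comp_snd _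
  have h3 := (memLp_sq_of_four _ _ ((h1.const_mul (Real.sqrt b)).add h2)).integrable (by norm_num)
  have h4 := (memLp_sq_of_four _ _ h2).integrable (by norm_num)
  have e1 : ∫ p, (Real.sqrt b * p.1 + p.2)^2 ∂((gaussianReal 0 v).prod (gaussianReal 0 1)) = sv b v := by
    rw [← gauss_sq_int, ← map_sum_gauss b hb, integral_map (by fun_prop) (by fun_prop)]
  have e2 : ∫ p, p.2^2 ∂((gaussianReal 0 v).prod (gaussianReal 0 1)) = 1 := by
    have := gauss_sq_int 1
    rw [← Measure.snd_prod (μ := gaussianReal 0 v) (ν := gaussianReal 0 1), Measure.snd,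
      integral_map (by fun_prop) (by fun_prop)] at this
    simpa using this
  unfold Tf
  have hs := sv_pos_real b v
  simp only [Pi.add_apply] at h3
  rw [integral_sub (h3.div_const _) (h4.div_const _), integral_div, integral_div, e1, e2]
  field_simp
  ring

def Vb (b : ℝ) (v : ℝ≥0) : ℝ := Var[Tf b v; (gaussianReal 0 v).prod (gaussianReal 0 1)]

lemma Vb_nonneg (b : ℝ) (v : ℝ≥0) : 0 ≤ Vb b v := variance_nonneg _ _

lemma second_moment {n : ℕ} (b : ℝ) (hb : 0 ≤ b) (v : ℝ≥0) :
    ∫⁻ x, ∫⁻ z, ENNReal.ofReal ((Real.log (wd b v x z) - n * (1/2 * Real.log (1 + b * v)))^2)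
      ∂(gaussOut b x) ∂(Measure.pi fun _ : Fin n => gaussianReal 0 v)
      = ENNReal.ofReal (n * Vb b v) := by
  rw [joint_lint b v (fun x z =>
    ENNReal.ofReal ((Real.log (wd b v x z) - n * (1/2 * Real.log (1 + b * v)))^2))]
  swap
  · have := wd_meas (n := n) b v
    exact (((Real.measurable_log.comp this).sub_const _).pow_const 2).ennreal_ofReal
  have h1 : ∀ ω : Fin n → ℝ × ℝ,
      Real.log (wd b v (fun i => (ω i).1) (fun i => Real.sqrt b * (ω i).1 + (ω i).2))
        - n * (1/2 * Real.log (1 + b * v)) = (∑ i, fun ω : Fin n → ℝ × ℝ => Tf b v (ω i)) ω := by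
    intro ω
    unfold wd
    rw [Real.log_exp, Finset.sum_apply, ← sv_coe b hb]
    have : (n : ℝ) * (1/2 * Real.log (sv b v)) = ∑ i : Fin n, 1/2 * Real.log (sv b v) := by simp
    rw [this, ← Finset.sum_sub_distrib]
    refine Finset.sum_congr rfl fun i _ => ?_
    unfold wdE Tf
    ring
  simp_rw [h1]
  have hL : ∀ i : Fin n, MemLp (fun ω : Fin n → ℝ × ℝ => Tf b v (ω i)) 2
      (Measure.pi fun _ : Fin n => (gaussianReal 0 v).prod (gaussianReal 0 1)) := fun i =>
    (Tf_memLp b v).comp_measurePreserving (measurePreserving_eval _ i)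
  have hS : MemLp (∑ i, fun ω : Fin n → ℝ × ℝ => Tf b v (ω i)) 2
      (Measure.pi fun _ : Fin n => (gaussianReal 0 v).prod (gaussianReal 0 1)) :=
    memLp_finsetSum' _ fun i _ => hL i
  have hvar := variance_sum_pi (μ := fun _ : Fin n => (gaussianReal 0 v).prod (gaussianReal 0 1))
    (X := fun _ => Tf b v) (fun _ => Tf_memLp b v)
  have hmean : ∫ ω, (∑ i, fun ω : Fin n → ℝ × ℝ => Tf b v (ω i)) ω
      ∂(Measure.pi fun _ : Fin n => (gaussianReal 0 v).prod (gaussianReal 0 1)) = 0 := by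
    simp_rw [Finset.sum_apply]
    rw [integral_finsetSum _ fun i _ => (hL i).integrable (by norm_num)]
    refine Finset.sum_eq_zero fun i _ => ?_
    have := integral_map (μ := Measure.pi fun _ : Fin n => (gaussianReal 0 v).prod (gaussianReal 0 1))
      (φ := fun ω => ω i) (measurable_pi_apply i).aemeasurable (f := Tf b v)
      (by rw [(measurePreserving_eval _ i).map_eq]; exact (Tf_memLp b v).1)
    rw [(measurePreserving_eval _ i).map_eq, Tf_mean b hb] at this
    exact this.symm
  rw [variance_of_integral_eq_zero hS.1.aemeasurable hmean] at hvar
  rw [← ofReal_integral_eq_lintegral_ofReal hS.integrable_sq (Filter.Eventually.of_forall fun _ => sq_nonneg _), hvar]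
  simp [Vb]

/-! ### Truncated Gaussian codebook law and expectation bounds -/

def powSet (n : ℕ) (P : ℝ) : Set (Fin n → ℝ) := {xs | ∑ i, (xs i) ^ 2 ≤ (n : ℝ) * P}

lemma powSet_meas (n : ℕ) (P : ℝ) : MeasurableSet (powSet n P) := by
  unfold powSet
  exact measurableSet_le (by fun_prop) (by fun_prop)

lemma powSet_prob {n : ℕ} (hn : 0 < n) (v : ℝ≥0) (P : ℝ) (hP : 0 < P) :
    ENNReal.ofReal (1 - v / P) ≤ (Measure.pi fun _ : Fin n => gaussianReal 0 v) (powSet n P) := by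
  set Q := Measure.pi fun _ : Fin n => gaussianReal 0 v with hQ
  have hn' : (0:ℝ) < n := by exact_mod_cast hn
  have hmom : ∀ i : Fin n, ∫⁻ x, ENNReal.ofReal ((x i)^2) ∂Q = ENNReal.ofReal v := by
    intro i
    have h1 : Measurable fun y : ℝ => ENNReal.ofReal (y^2) := by fun_prop
    have h2 := (measurePreserving_eval (fun _ : Fin n => gaussianReal 0 v) i).lintegral_comp h1
    have h3 : Integrable (fun y : ℝ => y^2) (gaussianReal 0 v) :=
      (memLp_id_gaussianReal' (μ := 0) (v := v) 2 (by simp)).integrable_sq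
    rw [← ofReal_integral_eq_lintegral_ofReal h3 (Filter.Eventually.of_forall fun _ => sq_nonneg _),
      gauss_sq_int] at h2
    exact h2
  have hm : Measurable fun x : Fin n → ℝ => ∑ i, ENNReal.ofReal ((x i)^2) := by fun_prop
  have hsum : ∫⁻ x, ∑ i, ENNReal.ofReal ((x i)^2) ∂Q = ENNReal.ofReal (n * v) := by
    rw [lintegral_finsetSum _ (fun i _ => by fun_prop)]
    simp_rw [hmom]
    rw [Finset.sum_const, Finset.card_univ, Fintype.card_fin, ENNReal.ofReal_mul hn'.le]
    simp
  have hmk := mul_meas_ge_le_lintegral (μ := Q) hm (ENNReal.ofReal (n * P))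
  rw [hsum] at hmk
  have hsub : (powSet n P)ᶜ ⊆ {x | ENNReal.ofReal (n * P) ≤ ∑ i, ENNReal.ofReal ((x i)^2)} := by
    intro x hx
    simp only [powSet, Set.mem_compl_iff, Set.mem_ofPred_eq, not_le] at hx ⊢
    rw [← ENNReal.ofReal_sum_of_nonneg (fun _ _ => sq_nonneg _)]
    exact ENNReal.ofReal_le_ofReal hx.le
  have h1 : Q (powSet n P)ᶜ ≤ ENNReal.ofReal (v / P) := by
    have h2 : ENNReal.ofReal (n * P) * Q (powSet n P)ᶜ ≤ ENNReal.ofReal (n * v) :=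
      (mul_le_mul_right (measure_mono hsub) _).trans hmk
    have h3 : ENNReal.ofReal (n * v) = ENNReal.ofReal (n * P) * ENNReal.ofReal (v / P) := by
      rw [← ENNReal.ofReal_mul (by positivity)]
      congr 1
      field_simp
    rw [h3] at h2
    exact (ENNReal.mul_le_mul_iff_right (ENNReal.ofReal_pos.2 (by positivity)).ne' ENNReal.ofReal_ne_top).1 h2
  have h2 := prob_add_prob_compl (μ := Q) (powSet_meas n P)
  rw [ENNReal.ofReal_sub _ (by positivity), ENNReal.ofReal_one, ← h2]
  exact tsub_le_iff_right.2 (by gcongr)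

def Qt (n : ℕ) (v : ℝ≥0) (P : ℝ) : Measure (Fin n → ℝ) :=
  ProbabilityTheory.cond (Measure.pi fun _ : Fin n => gaussianReal 0 v) (powSet n P)

lemma Qt_prob {n : ℕ} (hn : 0 < n) (v : ℝ≥0) (P : ℝ) (hP : 0 < P) (hv : v < P) :
    IsProbabilityMeasure (Qt n v P) := by
  refine cond_isProbabilityMeasure ?_
  have h := powSet_prob hn v P hP
  have : 0 < ENNReal.ofReal (1 - v / P) := by
    rw [ENNReal.ofReal_pos, sub_pos, div_lt_one hP]; exact hv
  exact (this.trans_le h).ne'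

lemma Qt_powSet {n : ℕ} (v : ℝ≥0) (P : ℝ) : Qt n v P (powSet n P)ᶜ = 0 := by
  unfold Qt
  rw [cond_apply (powSet_meas n P)]
  simp

def cc (v : ℝ≥0) (P : ℝ) : ℝ := (1 - v / P)⁻¹

lemma cc_pos (v : ℝ≥0) (P : ℝ) (hP : 0 < P) (hv : v < P) : 0 < cc v P := by
  unfold cc
  rw [inv_pos, sub_pos, div_lt_one hP]; exact hv

lemma Qt_lint {n : ℕ} (hn : 0 < n) (v : ℝ≥0) (P : ℝ) (hP : 0 < P) (hv : v < P)
    (f : (Fin n → ℝ) → ℝ≥0∞) :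
    ∫⁻ x, f x ∂(Qt n v P) ≤ ENNReal.ofReal (cc v P) *
      ∫⁻ x, f x ∂(Measure.pi fun _ : Fin n => gaussianReal 0 v) := by
  have h0 : (0:ℝ) < 1 - v / P := by rw [sub_pos, div_lt_one hP]; exact hv
  unfold Qt ProbabilityTheory.cond
  rw [lintegral_smul_measure, smul_eq_mul, cc, ENNReal.ofReal_inv_of_pos h0]
  exact mul_le_mul' (ENNReal.inv_le_inv.2 (powSet_prob hn v P hP))
    (lintegral_mono' Measure.restrict_le_self le_rfl)

lemma Qt_hc {n : ℕ} (hn : 0 < n) (v : ℝ≥0) (P : ℝ) (hP : 0 < P) (hv : v < P)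
    (b : ℝ) (hb : 0 ≤ b) (f : (Fin n → ℝ) → ℝ≥0∞) (hf : Measurable f) :
    ∫⁻ x, ∫⁻ z, ENNReal.ofReal (wd b v x z) * f z ∂(outR n b v) ∂(Qt n v P)
      ≤ ENNReal.ofReal (cc v P) * ∫⁻ z, f z ∂(outR n b v) := by
  refine (Qt_lint hn v P hP hv _).trans ?_
  rw [← out_marg b hb v f hf]
  simp_rw [lint_gaussOut b v _ f hf]
  exact le_rfl

lemma log_bound (w L s θ : ℝ) (hw : 0 < w) (hL : 0 < L) (hs : s ≤ Real.log L) (hθ : 0 < θ) :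
    Real.log (1 + w / L) ≤ (Real.log 2 + θ) + θ⁻¹ * (Real.log w - s)^2 := by
  have h1 : w / L ≤ Real.exp |Real.log w - s| := by
    rw [← Real.exp_log (div_pos hw hL), Real.log_div hw.ne' hL.ne']
    exact Real.exp_le_exp.2 ((by linarith : _ ≤ Real.log w - s).trans (le_abs_self _))
  have h2 : 1 ≤ Real.exp |Real.log w - s| := Real.one_le_exp (abs_nonneg _)
  have h3 : Real.log (1 + w / L) ≤ Real.log (2 * Real.exp |Real.log w - s|) :=
    Real.log_le_log (by positivity) (by linarith)
  rw [Real.log_mul (by norm_num) (Real.exp_ne_zero _), Real.log_exp] at h3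
  have h4 : |Real.log w - s| ≤ θ + θ⁻¹ * (Real.log w - s)^2 := by
    rw [← sq_abs]
    generalize |Real.log w - s| = t
    have : 0 ≤ θ⁻¹ * ((t - θ)^2 + t * θ) ∨ t < 0 := by
      by_cases ht : 0 ≤ t
      · left; positivity
      · right; linarith
    rcases this with h | h
    · have e : θ⁻¹ * ((t - θ)^2 + t * θ) = θ + θ⁻¹ * t^2 - t := by field_simp; ring
      linarith
    · have : 0 ≤ θ + θ⁻¹ * t^2 := by positivity
      linarith
  linarith

lemma leakCore {n : ℕ} (hn : 0 < n) (v : ℝ≥0) (P : ℝ) (hP : 0 < P) (hv : v < P)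
    (b : ℝ) (hb : 0 ≤ b) {J L : Type*} [Fintype J] [Fintype L] [Nonempty L] (e : L → J)
    (he : Function.Injective e)
    (hL : n * (1/2 * Real.log (1 + b * v)) ≤ Real.log (Fintype.card L)) (θ : ℝ) (hθ : 0 < θ) :
    ∫⁻ C, ∫⁻ z, ENNReal.ofReal (((Fintype.card L : ℝ)⁻¹ * ∑ l, wd b v (C (e l)) z) *
        Real.log (1 + (Fintype.card L : ℝ)⁻¹ * ∑ l, wd b v (C (e l)) z)) ∂(outR n b v)
        ∂(Measure.pi fun _ : J => Qt n v P)
      ≤ ENNReal.ofReal (cc v P * (1 + Real.log 2 + n * θ + Vb b v / θ)) := by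
  have := Qt_prob hn v P hP hv
  have hn' : (0:ℝ) < n := by exact_mod_cast hn
  have hV := Vb_nonneg b v
  have hc0 := cc_pos v P hP hv
  have hl2 := Real.log_pos (by norm_num : (1:ℝ) < 2)
  refine (leakE (Qt n v P) (outR n b v) (wd b v) (wd_meas b v) (wd_pos b v) (wd_one b v)
    (ENNReal.ofReal (cc v P)) (Qt_hc hn v P hP hv b hb) e he).trans ?_
  have hcard : (0:ℝ) < Fintype.card L := by exact_mod_cast Fintype.card_pos
  obtain ⟨F, hF⟩ : ∃ F : (Fin n → ℝ) → (Fin n → ℝ) → ℝ≥0∞, F = fun x z =>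
    ENNReal.ofReal ((Real.log (wd b v x z) - n * (1/2 * Real.log (1 + b * v)))^2) := ⟨_, rfl⟩
  have hsm : ∫⁻ x, ∫⁻ z, F x z ∂(gaussOut b x) ∂(Measure.pi fun _ : Fin n => gaussianReal 0 v)
      = ENNReal.ofReal (n * Vb b v) := by
    rw [hF]; exact second_moment b hb v
  have hFm : Measurable (Function.uncurry F) := by
    rw [hF]
    exact (((Real.measurable_log.comp (wd_meas (n := n) b v)).sub_const _).pow_const 2).ennreal_ofReal
  have hFx : ∀ x, Measurable (F x) := fun x => hFm.comp measurable_prodMk_left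
  have hpt : ∀ x z, ENNReal.ofReal (wd b v x z * Real.log (1 + wd b v x z / Fintype.card L))
      ≤ ENNReal.ofReal (wd b v x z) * (ENNReal.ofReal (Real.log 2 + n * θ)
        + ENNReal.ofReal ((n * θ)⁻¹) * F x z) := by
    intro x z
    have h1 := log_bound (wd b v x z) (Fintype.card L) _ (n * θ) (wd_pos b v x z) hcard hL
      (by positivity)
    simp only [hF]
    rw [← ENNReal.ofReal_mul (by positivity), ← ENNReal.ofReal_add (by positivity) (by positivity),
      ← ENNReal.ofReal_mul (wd_pos b v x z).le]
    exact ENNReal.ofReal_le_ofReal (mul_le_mul_of_nonneg_left h1 (wd_pos b v x z).le)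
  have hx : ∀ x, ∫⁻ z, ENNReal.ofReal (wd b v x z * Real.log (1 + wd b v x z / Fintype.card L))
      ∂(outR n b v) ≤ ENNReal.ofReal (Real.log 2 + n * θ)
        + ENNReal.ofReal ((n * θ)⁻¹) * ∫⁻ z, F x z ∂(gaussOut b x) := by
    intro x
    refine (lintegral_mono (hpt x)).trans ?_
    have hm : Measurable fun z => ENNReal.ofReal (Real.log 2 + n * θ)
        + ENNReal.ofReal ((n * θ)⁻¹) * F x z := ((hFx x).const_mul _).const_add _
    have hm2 : Measurable fun z => ENNReal.ofReal ((n * θ)⁻¹) * F x z := (hFx x).const_mul _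
    rw [← lint_gaussOut b v x _ hm, lintegral_add_right _ hm2, lintegral_const, measure_univ, mul_one,
      lintegral_const_mul _ (hFx x)]
  have hG : Measurable fun x => ∫⁻ z, F x z ∂(gaussOut b x) := by
    have : ∀ x, ∫⁻ z, F x z ∂(gaussOut b x) = ∫⁻ z, ENNReal.ofReal (wd b v x z) * F x z ∂(outR n b v) :=
      fun x => lint_gaussOut b v x _ (hFx x)
    simp_rw [this]
    exact Measurable.lintegral_prod_right' (f := fun p : (Fin n → ℝ) × (Fin n → ℝ) =>
      ENNReal.ofReal (wd b v p.1 p.2) * F p.1 p.2) ((wd_meas b v).ennreal_ofReal.mul hFm)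
  have hfin : ∫⁻ x, ∫⁻ z, ENNReal.ofReal (wd b v x z * Real.log (1 + wd b v x z / Fintype.card L))
      ∂(outR n b v) ∂(Qt n v P) ≤ ENNReal.ofReal (cc v P) * (ENNReal.ofReal (Real.log 2 + n * θ)
        + ENNReal.ofReal ((n * θ)⁻¹) * ENNReal.ofReal (n * Vb b v)) := by
    refine (Qt_lint hn v P hP hv _).trans (mul_le_mul_right ((lintegral_mono hx).trans ?_) _)
    rw [lintegral_add_right _ (hG.const_mul _), lintegral_const, measure_univ, mul_one, lintegral_const_mul _ hG, hsm]
  refine (add_le_add le_rfl hfin).trans ?_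
  rw [← ENNReal.ofReal_mul (by positivity), ← ENNReal.ofReal_add (by positivity) (by positivity),
    ← ENNReal.ofReal_mul hc0.le, ← ENNReal.ofReal_add (by positivity) (by positivity)]
  refine ENNReal.ofReal_le_ofReal (le_of_eq ?_)
  field_simp
  ring

def gErr {n : ℕ} (b : ℝ) (v : ℝ≥0) (δ : ℝ) (x z : Fin n → ℝ) : ℝ≥0∞ :=
  ENNReal.ofReal (((n * δ)^2)⁻¹) *
    ENNReal.ofReal ((Real.log (wd b v x z) - n * (1/2 * Real.log (1 + b * v)))^2)

lemma gErr_meas {n : ℕ} (b : ℝ) (v : ℝ≥0) (δ : ℝ) :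
    Measurable (Function.uncurry (gErr (n := n) b v δ)) :=
  ((((Real.measurable_log.comp (wd_meas (n := n) b v)).sub_const _).pow_const 2).ennreal_ofReal).const_mul _

lemma gErr_ge {n : ℕ} (hn : 0 < n) (b : ℝ) (v : ℝ≥0) (δ : ℝ) (hδ : 0 < δ) (x z : Fin n → ℝ)
    (h : wd b v x z ≤ Real.exp (n * (1/2 * Real.log (1 + b * v) - δ))) : 1 ≤ gErr b v δ x z := by
  have hn' : (0:ℝ) < n := by exact_mod_cast hn
  have h1 : Real.log (wd b v x z) ≤ n * (1/2 * Real.log (1 + b * v) - δ) := by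
    rwa [Real.log_le_iff_le_exp (wd_pos b v x z)]
  unfold gErr
  rw [← ENNReal.ofReal_mul (by positivity), ENNReal.one_le_ofReal, ← div_eq_inv_mul,
    one_le_div (by positivity), ← sq_abs (Real.log _ - _)]
  refine pow_le_pow_left₀ (by positivity) ?_ 2
  rw [abs_of_nonpos] <;> nlinarith [mul_pos hn' hδ]

lemma errCore {n : ℕ} (hn : 0 < n) (v : ℝ≥0) (P : ℝ) (hP : 0 < P) (hv : v < P)
    (b : ℝ) (hb : 0 ≤ b) {J : Type*} [Fintype J] [Nonempty J] [DecidableEq J] (δ : ℝ) (hδ : 0 < δ) :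
    ∫⁻ C, errB (outR n b v) (wd b v) (gErr b v δ)
        (Real.exp (n * (1/2 * Real.log (1 + b * v) - δ))) C ∂(Measure.pi fun _ : J => Qt n v P)
      ≤ ENNReal.ofReal (cc v P * (Vb b v / (n * δ^2)
        + Real.exp (-(n * (1/2 * Real.log (1 + b * v) - δ))) * Fintype.card J)) := by
  have := Qt_prob hn v P hP hv
  have hn' : (0:ℝ) < n := by exact_mod_cast hn
  have hV := Vb_nonneg b v
  have hc0 := cc_pos v P hP hv
  refine (errE (Qt n v P) (outR n b v) (wd b v) (wd_meas b v) (wd_one b v)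
    (ENNReal.ofReal (cc v P)) (Qt_hc hn v P hP hv b hb) (gErr b v δ) (gErr_meas b v δ) _).trans ?_
  have h1 : ∫⁻ x, ∫⁻ z, ENNReal.ofReal (wd b v x z) * gErr b v δ x z ∂(outR n b v) ∂(Qt n v P)
      ≤ ENNReal.ofReal (cc v P) * (ENNReal.ofReal (((n * δ)^2)⁻¹) * ENNReal.ofReal (n * Vb b v)) := by
    refine (Qt_lint hn v P hP hv _).trans (mul_le_mul_right (le_of_eq ?_) _)
    have hsm := second_moment (n := n) b hb v
    rw [← hsm, ← lintegral_const_mul' (ENNReal.ofReal (((n * δ)^2)⁻¹)) _ ENNReal.ofReal_ne_top]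
    refine lintegral_congr fun x => ?_
    have hg : Measurable (gErr b v δ x) := Measurable.of_uncurry_left (gErr_meas (n := n) b v δ)
    have h5 := lint_gaussOut b v x _ hg
    rw [← h5]
    unfold gErr
    rw [lintegral_const_mul' _ _ ENNReal.ofReal_ne_top]
  refine (add_le_add h1 le_rfl).trans ?_
  have h2 : (Fintype.card J : ℝ≥0∞) = ENNReal.ofReal (Fintype.card J) := by simp
  rw [h2, ← ENNReal.ofReal_mul (by positivity), ← ENNReal.ofReal_mul (by positivity),
    ← ENNReal.ofReal_mul (by positivity), ← ENNReal.ofReal_mul (by positivity),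
    ← ENNReal.ofReal_add (by positivity) (by positivity), ← Real.exp_neg]
  refine ENNReal.ofReal_le_ofReal (le_of_eq ?_)
  field_simp

/-! ### From codebooks to codes -/

section Code

variable {n : ℕ} {J M L : Type*} [Fintype M] [Fintype L]

def pAvg (b : ℝ) (v : ℝ≥0) (e : M → L → J) (C : J → Fin n → ℝ) (m : M) (z : Fin n → ℝ) : ℝ :=
  (Fintype.card L : ℝ)⁻¹ * ∑ l, wd b v (C (e m l)) z

def lk (b : ℝ) (v : ℝ≥0) (e : M → L → J) (C : J → Fin n → ℝ) : ℝ≥0∞ :=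
  (Fintype.card M : ℝ≥0∞)⁻¹ * ∑ m, ∫⁻ z, ENNReal.ofReal (pAvg b v e C m z *
    Real.log (1 + pAvg b v e C m z)) ∂(outR n b v)

lemma wd_meas_right (b : ℝ) (v : ℝ≥0) (x : Fin n → ℝ) : Measurable (wd b v x) :=
  Measurable.of_uncurry_left (wd_meas (n := n) b v)

lemma pAvg_meas_right (b : ℝ) (v : ℝ≥0) (e : M → L → J) (C : J → Fin n → ℝ) (m : M) :
    Measurable (pAvg b v e C m) := by
  unfold pAvg
  exact (Finset.measurable_fun_sum _ fun l _ => wd_meas_right b v _).const_mul _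

lemma lint_avg (b : ℝ) (v : ℝ≥0) [Nonempty L] (e : M → L → J) (C : J → Fin n → ℝ) (m : M)
    (f : (Fin n → ℝ) → ℝ≥0∞) (hf : Measurable f) :
    ∫⁻ z, ENNReal.ofReal (pAvg b v e C m z) * f z ∂(outR n b v)
      = (Fintype.card L : ℝ≥0∞)⁻¹ * ∑ l, ∫⁻ z, ENNReal.ofReal (wd b v (C (e m l)) z) * f z ∂(outR n b v) := by
  have hcard : (0:ℝ) < Fintype.card L := by exact_mod_cast Fintype.card_pos
  have h : ∀ z, ENNReal.ofReal (pAvg b v e C m z) * f z =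
      (Fintype.card L : ℝ≥0∞)⁻¹ * ∑ l, ENNReal.ofReal (wd b v (C (e m l)) z) * f z := by
    intro z
    unfold pAvg
    rw [ENNReal.ofReal_mul (by positivity), ENNReal.ofReal_inv_of_pos hcard,
      ENNReal.ofReal_sum_of_nonneg fun l _ => (wd_pos b v _ z).le, ENNReal.ofReal_natCast, mul_assoc,
      Finset.sum_mul]
  have hm : ∀ l, Measurable fun z => ENNReal.ofReal (wd b v (C (e m l)) z) * f z :=
    fun l => ((wd_meas_right b v _).ennreal_ofReal).mul hf
  have hm2 : Measurable fun z => ∑ l, ENNReal.ofReal (wd b v (C (e m l)) z) * f z :=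
    Finset.measurable_fun_sum _ fun l _ => hm l
  simp_rw [h]
  rw [lintegral_const_mul _ hm2, lintegral_finsetSum _ fun l _ => hm l]

lemma lint_avg_gauss (b : ℝ) (v : ℝ≥0) [Nonempty L] (e : M → L → J) (C : J → Fin n → ℝ) (m : M)
    (f : (Fin n → ℝ) → ℝ≥0∞) (hf : Measurable f) :
    ∫⁻ z, f z ∂((outR n b v).withDensity fun z => ENNReal.ofReal (pAvg b v e C m z))
      = (Fintype.card L : ℝ≥0∞)⁻¹ * ∑ l, ∫⁻ z, f z ∂(gaussOut b (C (e m l))) := by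
  rw [lintegral_withDensity_eq_lintegral_mul _ (pAvg_meas_right b v e C m).ennreal_ofReal hf]
  simp_rw [lint_gaussOut b v _ f hf]
  exact lint_avg b v e C m f hf

lemma pAvg_pos (b : ℝ) (v : ℝ≥0) [Nonempty L] (e : M → L → J) (C : J → Fin n → ℝ) (m : M)
    (z : Fin n → ℝ) : 0 < pAvg b v e C m z := by
  have hcard : (0:ℝ) < Fintype.card L := by exact_mod_cast Fintype.card_pos
  unfold pAvg
  exact mul_pos (inv_pos.2 hcard) (Finset.sum_pos (fun l _ => wd_pos b v _ z) Finset.univ_nonempty)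

lemma pAvg_one (b : ℝ) (v : ℝ≥0) [Nonempty L] (e : M → L → J) (C : J → Fin n → ℝ) (m : M) :
    ∫⁻ z, ENNReal.ofReal (pAvg b v e C m z) ∂(outR n b v) = 1 := by
  have h := lint_avg b v e C m (fun _ => 1) measurable_const
  simp only [mul_one, wd_one, Finset.sum_const, Finset.card_univ, nsmul_eq_mul] at h
  rw [h]
  exact ENNReal.inv_mul_cancel (by simp) (by simp)

lemma lk_mi [Nonempty M] [MeasurableSpace M] [MeasurableSingletonClass M] [Nonempty L]
    (b : ℝ) (v : ℝ≥0) (e : M → L → J) (C : J → Fin n → ℝ) :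
    ENNReal.ofReal (miBits (mixLaw fun m => (outR n b v).withDensity fun z =>
      ENNReal.ofReal (pAvg b v e C m z)) * Real.log 2) ≤ 1 + lk b v e C :=
  miBits_mix_le (outR n b v) (pAvg b v e C) (pAvg_meas_right b v e C) (pAvg_pos b v e C)
    (pAvg_one b v e C)

lemma lk_aux_meas (b : ℝ) (v : ℝ≥0) (e : M → L → J) (m : M) :
    Measurable fun C : J → Fin n → ℝ => ∫⁻ z, ENNReal.ofReal (pAvg b v e C m z *
      Real.log (1 + pAvg b v e C m z)) ∂(outR n b v) := by
  have h : Measurable fun p : (J → Fin n → ℝ) × (Fin n → ℝ) => pAvg b v e p.1 m p.2 := by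
    unfold pAvg
    refine (Finset.measurable_fun_sum _ fun l _ => ?_).const_mul _
    have h1 : Measurable fun p : (J → Fin n → ℝ) × (Fin n → ℝ) => (p.1 (e m l), p.2) := by fun_prop
    have h2 := (wd_meas (n := n) b v).comp h1
    exact h2
  exact Measurable.lintegral_prod_right' (f := fun p : (J → Fin n → ℝ) × (Fin n → ℝ) =>
    ENNReal.ofReal (pAvg b v e p.1 m p.2 * Real.log (1 + pAvg b v e p.1 m p.2)))
    (h.mul (Real.measurable_log.comp (h.const_add 1))).ennreal_ofReal

lemma lk_meas (b : ℝ) (v : ℝ≥0) (e : M → L → J) : Measurable (lk (n := n) b v e) := by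
  unfold lk
  exact (Finset.measurable_fun_sum _ fun m _ => lk_aux_meas b v e m).const_mul _

lemma lk_E [Fintype J] [Nonempty M] [Nonempty L] (hn : 0 < n) (v : ℝ≥0) (P : ℝ) (hP : 0 < P)
    (hv : v < P) (b : ℝ) (hb : 0 ≤ b) (e : M → L → J) (he : ∀ m, Function.Injective (e m))
    (hL : n * (1/2 * Real.log (1 + b * v)) ≤ Real.log (Fintype.card L)) (θ : ℝ) (hθ : 0 < θ) :
    ∫⁻ C, lk b v e C ∂(Measure.pi fun _ : J => Qt n v P)
      ≤ ENNReal.ofReal (cc v P * (1 + Real.log 2 + n * θ + Vb b v / θ)) := by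
  unfold lk
  rw [lintegral_const_mul _ (Finset.measurable_fun_sum _ fun m _ => lk_aux_meas b v e m),
    lintegral_finsetSum _ fun m _ => lk_aux_meas b v e m]
  have h : ∀ m ∈ Finset.univ, ∫⁻ C : J → Fin n → ℝ, ∫⁻ z, ENNReal.ofReal (pAvg b v e C m z *
      Real.log (1 + pAvg b v e C m z)) ∂(outR n b v) ∂(Measure.pi fun _ : J => Qt n v P) ≤
      ENNReal.ofReal (cc v P * (1 + Real.log 2 + n * θ + Vb b v / θ)) := fun m _ =>
    leakCore hn v P hP hv b hb (e m) (he m) hL θ hθ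
  refine (mul_le_mul_right (Finset.sum_le_sum h) _).trans ?_
  rw [Finset.sum_const, Finset.card_univ, nsmul_eq_mul, ← mul_assoc,
    ENNReal.inv_mul_cancel (by simp) (by simp), one_mul]

end Code

lemma natCast_mul_inv (k l : ℕ) : (((k * l : ℕ) : ℝ≥0∞))⁻¹ = (k : ℝ≥0∞)⁻¹ * (l : ℝ≥0∞)⁻¹ := by
  rw [Nat.cast_mul, ENNReal.mul_inv (Or.inr (ENNReal.natCast_ne_top _)) (Or.inl (ENNReal.natCast_ne_top _))]

section Enc

variable {n K₁ K₂ K₃ : ℕ}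

def encC (C : Fin K₁ × Fin K₂ × Fin K₃ → Fin n → ℝ) (m : Fin K₁ × Fin K₂) :
    Measure (Fin n → ℝ) :=
  (unifM (Fin K₃)).map fun k => C (m.1, m.2, k)

def e2 (m : Fin K₁ × Fin K₂) (k : Fin K₃) : Fin K₁ × Fin K₂ × Fin K₃ := (m.1, m.2, k)
def e1 (m : Fin K₁) (k : Fin K₂ × Fin K₃) : Fin K₁ × Fin K₂ × Fin K₃ := (m, k)

lemma encC_prob [Nonempty (Fin K₃)] (C : Fin K₁ × Fin K₂ × Fin K₃ → Fin n → ℝ)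
    (m : Fin K₁ × Fin K₂) : IsProbabilityMeasure (encC C m) := by
  unfold encC
  exact Measure.isProbabilityMeasure_map (measurable_of_finite _).aemeasurable

lemma encC_pow [Nonempty (Fin K₃)] (C : Fin K₁ × Fin K₂ × Fin K₃ → Fin n → ℝ) (P : ℝ)
    (hC : ∀ j, C j ∈ powSet n P) (m : Fin K₁ × Fin K₂) :
    encC C m {xs | ∑ i, (xs i) ^ 2 ≤ (n : ℝ) * P} = 1 := by
  change encC C m (powSet n P) = 1
  unfold encC
  rw [Measure.map_apply (measurable_of_finite _) (powSet_meas n P),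
    show (fun k => C (m.1, m.2, k)) ⁻¹' (powSet n P) = Set.univ from
      Set.eq_univ_of_forall fun k => hC _]
  exact measure_univ

lemma encC_bind [Nonempty (Fin K₃)] (C : Fin K₁ × Fin K₂ × Fin K₃ → Fin n → ℝ) (b : ℝ) (v : ℝ≥0)
    (m : Fin K₁ × Fin K₂) :
    (encC C m).bind (gaussOut b) =
      (outR n b v).withDensity fun z => ENNReal.ofReal (pAvg b v e2 C m z) := by
  refine Measure.ext_of_lintegral _ fun f hf => ?_
  have hm : Measurable fun x : Fin n → ℝ => ∫⁻ z, f z ∂(gaussOut b x) :=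
    (Measure.measurable_lintegral hf).comp (gaussOut_meas b)
  rw [Measure.lintegral_bind (gaussOut_meas b).aemeasurable hf.aemeasurable, lint_avg_gauss b v e2 C m f hf]
  unfold encC
  rw [lintegral_map hm (measurable_of_finite _), lintegral_unifM]
  rfl

lemma jointLaw_mix (b : ℝ) (enc : Fin K₁ × Fin K₂ → Measure (Fin n → ℝ)) :
    jointLaw b enc = mixLaw fun m => (enc m).bind (gaussOut b) := by
  unfold jointLaw mixLaw
  simp

lemma jointLaw_encC [Nonempty (Fin K₃)] (C : Fin K₁ × Fin K₂ × Fin K₃ → Fin n → ℝ) (b : ℝ) (v : ℝ≥0) :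
    jointLaw b (encC C) = mixLaw fun m => (outR n b v).withDensity fun z =>
      ENNReal.ofReal (pAvg b v e2 C m z) := by
  rw [jointLaw_mix]
  simp_rw [encC_bind C b v]

lemma wd_avg_prob {J M L : Type*} [Fintype M] [Fintype L] [Nonempty L] (b : ℝ) (v : ℝ≥0)
    (e : M → L → J) (C : J → Fin n → ℝ) (m : M) :
    IsProbabilityMeasure ((outR n b v).withDensity fun z => ENNReal.ofReal (pAvg b v e C m z)) :=
  ⟨by rw [withDensity_apply _ MeasurableSet.univ, setLIntegral_univ, pAvg_one]⟩

lemma jointLaw_map [Nonempty (Fin K₂)] [Nonempty (Fin K₃)]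
    (C : Fin K₁ × Fin K₂ × Fin K₃ → Fin n → ℝ) (b : ℝ) (v : ℝ≥0) :
    (jointLaw b (encC C)).map (fun p => (p.1.1, p.2)) =
      mixLaw fun m => (outR n b v).withDensity fun z => ENNReal.ofReal (pAvg b v e1 C m z) := by
  rw [jointLaw_encC C b v]
  refine Measure.ext_of_lintegral _ fun f hf => ?_
  have i1 := fun m => wd_avg_prob b v e2 C m
  have i2 := fun m => wd_avg_prob b v e1 C m
  have hm : Measurable fun p : (Fin K₁ × Fin K₂) × (Fin n → ℝ) => (p.1.1, p.2) := by fun_prop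
  have hfh : Measurable fun p : (Fin K₁ × Fin K₂) × (Fin n → ℝ) => f (p.1.1, p.2) := hf.comp hm
  rw [lintegral_map hf hm, lintegral_mixLaw _ _ hfh,
    lintegral_mixLaw _ _ hf]
  have hfm : ∀ m, Measurable fun z => f (m, z) := fun m => hf.comp measurable_prodMk_left
  simp_rw [fun m : Fin K₁ × Fin K₂ => lint_avg_gauss b v e2 C m (fun z => f (m.1, z)) (hfm m.1),
    fun m : Fin K₁ => lint_avg_gauss b v e1 C m (fun z => f (m, z)) (hfm m)]
  rw [← Finset.mul_sum, ← Finset.mul_sum, ← mul_assoc, ← mul_assoc, Fintype.sum_prod_type]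
  congr 1
  · simp only [Fintype.card_prod, Fintype.card_fin, Nat.cast_mul]
    rw [ENNReal.mul_inv (by simp) (by simp), ENNReal.mul_inv (by simp) (by simp), mul_assoc]
  · refine Finset.sum_congr rfl fun m _ => ?_
    rw [Fintype.sum_prod_type]
    rfl

lemma jointLaw_prob [Nonempty (Fin K₁)] [Nonempty (Fin K₂)] (b : ℝ)
    (enc : Fin K₁ × Fin K₂ → Measure (Fin n → ℝ))
    (h : ∀ m, IsProbabilityMeasure (enc m)) : IsProbabilityMeasure (jointLaw b enc) := by
  have hp : ∀ m, IsProbabilityMeasure ((enc m).bind (gaussOut b)) := fun m => ⟨by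
    rw [Measure.bind_apply MeasurableSet.univ (gaussOut_meas b).aemeasurable]
    simp⟩
  rw [jointLaw_mix]
  refine ⟨?_⟩
  rw [← lintegral_one, lintegral_mixLaw _ _ measurable_const]
  simp only [lintegral_const, measure_univ, mul_one, Finset.sum_const, Finset.card_univ, nsmul_eq_mul]
  exact ENNReal.inv_mul_cancel (by exact_mod_cast Fintype.card_ne_zero) (ENNReal.natCast_ne_top _)

lemma err_bound [Nonempty (Fin K₁)] [Nonempty (Fin K₂)] [Nonempty (Fin K₃)]
    (C : Fin K₁ × Fin K₂ × Fin K₃ → Fin n → ℝ) (a : ℝ) (v : ℝ≥0)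
    (g : (Fin n → ℝ) → (Fin n → ℝ) → ℝ≥0∞) (γ : ℝ) (hγ : 0 < γ)
    (hg : ∀ x z, wd a v x z ≤ γ → 1 ≤ g x z) :
    ∃ dec : (Fin n → ℝ) → Fin K₁ × Fin K₂, Measurable dec ∧
      jointLaw a (encC C) {p | dec p.2 ≠ p.1} ≤ errB (outR n a v) (wd a v) g γ C := by
  obtain ⟨D, hD, hD2⟩ := exists_decoder (wd a v) (wd_meas a v) g γ hγ hg C
  refine ⟨fun z => ((D z).1, (D z).2.1), by fun_prop, ?_⟩
  have hms : MeasurableSet {p : (Fin K₁ × Fin K₂) × (Fin n → ℝ) | ((D p.2).1, (D p.2).2.1) ≠ p.1} :=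
    (measurableSet_eq_fun (by fun_prop) (by fun_prop)).compl
  have i1 := fun m => wd_avg_prob a v e2 C m
  rw [jointLaw_encC C a v, ← lintegral_indicator_one hms,
    lintegral_mixLaw _ _ (measurable_one.indicator hms)]
  have hfm : ∀ m, Measurable fun z => ({p : (Fin K₁ × Fin K₂) × (Fin n → ℝ) |
      ((D p.2).1, (D p.2).2.1) ≠ p.1}.indicator (1 : (Fin K₁ × Fin K₂) × (Fin n → ℝ) → ℝ≥0∞)) (m, z) :=
    fun m => (measurable_one.indicator hms).comp measurable_prodMk_left
  simp_rw [fun m : Fin K₁ × Fin K₂ => lint_avg_gauss a v e2 C m _ (hfm m)]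
  unfold errB
  rw [← Finset.mul_sum, ← mul_assoc]
  have hcard : (Fintype.card (Fin K₁ × Fin K₂) : ℝ≥0∞)⁻¹ * (Fintype.card (Fin K₃) : ℝ≥0∞)⁻¹
      = (Fintype.card (Fin K₁ × Fin K₂ × Fin K₃) : ℝ≥0∞)⁻¹ := by
    simp only [Fintype.card_prod, Fintype.card_fin, natCast_mul_inv, mul_assoc]
  rw [hcard]
  refine mul_le_mul_right ?_ _
  simp only [Fintype.sum_prod_type]
  refine Finset.sum_le_sum fun m1 _ => Finset.sum_le_sum fun m2 _ => Finset.sum_le_sum fun k _ => ?_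
  rw [lint_gaussOut a v _ _ (hfm (m1, m2))]
  refine lintegral_mono fun z => mul_le_mul_right ?_ _
  by_cases h : ((m1, m2), z) ∈ {p : (Fin K₁ × Fin K₂) × (Fin n → ℝ) |
      ((D p.2).1, (D p.2).2.1) ≠ p.1}
  · rw [Set.indicator_of_mem h]
    have h2 : D z ≠ (m1, m2, k) := fun h3 => h (by simp [h3])
    exact hD2 (m1, m2, k) z h2
  · rw [Set.indicator_of_notMem h]
    exact zero_le

end Enc

/-! ### The random coding argument -/

lemma choose3 {Ω : Type*} [MeasurableSpace Ω] (μ : Measure Ω) [IsProbabilityMeasure μ]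
    (f₁ f₂ f₃ : Ω → ℝ≥0∞) (h₁ : Measurable f₁) (h₂ : Measurable f₂) (h₃ : Measurable f₃)
    (B₁ B₂ B₃ : ℝ) (p₁ : 0 < B₁) (p₂ : 0 < B₂) (p₃ : 0 < B₃)
    (i₁ : ∫⁻ x, f₁ x ∂μ ≤ ENNReal.ofReal B₁) (i₂ : ∫⁻ x, f₂ x ∂μ ≤ ENNReal.ofReal B₂)
    (i₃ : ∫⁻ x, f₃ x ∂μ ≤ ENNReal.ofReal B₃) (N : Set Ω) (hN : μ N = 0) :
    ∃ x, x ∉ N ∧ f₁ x ≤ ENNReal.ofReal (3 * B₁) ∧ f₂ x ≤ ENNReal.ofReal (3 * B₂)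
      ∧ f₃ x ≤ ENNReal.ofReal (3 * B₃) := by
  have key : ∀ B : ℝ, 0 < B → (ENNReal.ofReal B)⁻¹ * ENNReal.ofReal B = 1 := fun B hB =>
    ENNReal.inv_mul_cancel (ENNReal.ofReal_pos.2 hB).ne' ENNReal.ofReal_ne_top
  have back : ∀ (B : ℝ) (y : ℝ≥0∞), 0 < B → (ENNReal.ofReal B)⁻¹ * y ≤ 3 →
      y ≤ ENNReal.ofReal (3 * B) := by
    intro B y hB hy
    have h := mul_le_mul_right hy (ENNReal.ofReal B)
    rw [← mul_assoc, mul_comm (ENNReal.ofReal B), key B hB, one_mul] at h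
    rw [mul_comm 3 B, ENNReal.ofReal_mul hB.le]
    simpa using h
  set F : Ω → ℝ≥0∞ := fun x => (ENNReal.ofReal B₁)⁻¹ * f₁ x + ((ENNReal.ofReal B₂)⁻¹ * f₂ x
    + (ENNReal.ofReal B₃)⁻¹ * f₃ x) with hF
  have hFm : Measurable F := (h₁.const_mul _).add ((h₂.const_mul _).add (h₃.const_mul _))
  obtain ⟨x, hx, hle⟩ := exists_notMem_null_le_lintegral hFm.aemeasurable hN
  have hmom : ∫⁻ x, F x ∂μ ≤ 3 := by
    rw [hF, lintegral_add_left (h₁.const_mul _), lintegral_add_left (h₂.const_mul _),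
      lintegral_const_mul _ h₁, lintegral_const_mul _ h₂, lintegral_const_mul _ h₃]
    calc _ ≤ (ENNReal.ofReal B₁)⁻¹ * ENNReal.ofReal B₁ + ((ENNReal.ofReal B₂)⁻¹ * ENNReal.ofReal B₂
          + (ENNReal.ofReal B₃)⁻¹ * ENNReal.ofReal B₃) := by gcongr
      _ = 3 := by rw [key _ p₁, key _ p₂, key _ p₃]; norm_num
  have h3 := hle.trans hmom
  refine ⟨x, hx, back _ _ p₁ (le_trans ?_ h3), back _ _ p₂ (le_trans ?_ h3),
    back _ _ p₃ (le_trans ?_ h3)⟩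
  · exact le_self_add
  · exact le_add_left le_self_add
  · exact le_add_left le_add_self

lemma ceil_exp_le (t : ℝ) (ht : 0 ≤ t) : ((⌈Real.exp t⌉₊ : ℕ) : ℝ) ≤ 2 * Real.exp t := by
  have h1 := Nat.ceil_lt_add_one (Real.exp_pos t).le
  have h2 := Real.one_le_exp ht
  linarith

lemma ceil_exp_pos (t : ℝ) : 0 < ⌈Real.exp t⌉₊ := Nat.ceil_pos.2 (Real.exp_pos t)

lemma log_ceil_exp (t : ℝ) : t ≤ Real.log (⌈Real.exp t⌉₊ : ℕ) := by
  rw [Real.le_log_iff_exp_le (by exact_mod_cast ceil_exp_pos t)]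
  exact Nat.le_ceil _

/-- One-shot code existence. -/
lemma code_exists {n : ℕ} (hn : 0 < n) (a b₁ b₂ P : ℝ) (v : ℝ≥0) (ha : 0 ≤ a) (hb₁ : 0 ≤ b₁)
    (hb₂ : 0 ≤ b₂) (hP : 0 < P) (hv : v < P) (K₁ K₂ K₃ : ℕ) (hK₁ : 0 < K₁) (hK₂ : 0 < K₂)
    (hK₃ : 0 < K₃) (δ θ : ℝ) (hδ : 0 < δ) (hθ : 0 < θ)
    (hL2 : n * (1/2 * Real.log (1 + b₂ * v)) ≤ Real.log K₃)
    (hL1 : n * (1/2 * Real.log (1 + b₁ * v)) ≤ Real.log (K₂ * K₃)) :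
    ∃ enc : Fin K₁ × Fin K₂ → Measure (Fin n → ℝ),
      (∀ m, IsProbabilityMeasure (enc m)) ∧
      (∀ m, enc m {xs | ∑ i, (xs i) ^ 2 ≤ (n : ℝ) * P} = 1) ∧
      ∃ dec : (Fin n → ℝ) → Fin K₁ × Fin K₂, Measurable dec ∧
        (jointLaw a enc {p | dec p.2 ≠ p.1}).toReal ≤ 3 * (cc v P * (Vb a v / (n * δ^2)
          + Real.exp (-(n * (1/2 * Real.log (1 + a * v) - δ))) * (K₁ * K₂ * K₃))) ∧
        miBits (jointLaw b₂ enc) * Real.log 2 ≤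
          1 + 3 * (cc v P * (1 + Real.log 2 + n * θ + Vb b₂ v / θ)) ∧
        miBits ((jointLaw b₁ enc).map fun p => (p.1.1, p.2)) * Real.log 2 ≤
          1 + 3 * (cc v P * (1 + Real.log 2 + n * θ + Vb b₁ v / θ)) := by
  have n1 : Nonempty (Fin K₁) := ⟨⟨0, hK₁⟩⟩
  have n2 : Nonempty (Fin K₂) := ⟨⟨0, hK₂⟩⟩
  have n3 : Nonempty (Fin K₃) := ⟨⟨0, hK₃⟩⟩
  have hn' : (0:ℝ) < n := by exact_mod_cast hn
  have hl2 := Real.log_pos (by norm_num : (1:ℝ) < 2)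
  have hc0 := cc_pos v P hP hv
  have hQ := Qt_prob hn v P hP hv
  have hVa := Vb_nonneg a v
  have hV1 := Vb_nonneg b₁ v
  have hV2 := Vb_nonneg b₂ v
  have hk1 : (0:ℝ) < K₁ := by exact_mod_cast hK₁
  have hk2 : (0:ℝ) < K₂ := by exact_mod_cast hK₂
  have hk3 : (0:ℝ) < K₃ := by exact_mod_cast hK₃
  have i1 := errCore hn v P hP hv a ha (J := Fin K₁ × Fin K₂ × Fin K₃) δ hδ
  have i2 := lk_E hn v P hP hv b₂ hb₂ (e2 (K₁ := K₁) (K₂ := K₂) (K₃ := K₃))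
    (fun m k k' h => by simpa [e2] using h) (by simpa using hL2) θ hθ
  have i3 := lk_E hn v P hP hv b₁ hb₁ (e1 (K₁ := K₁) (K₂ := K₂) (K₃ := K₃))
    (fun m k k' h => by simpa [e1] using h) (by simpa using hL1) θ hθ
  have hcardJ : (Fintype.card (Fin K₁ × Fin K₂ × Fin K₃) : ℝ) = K₁ * K₂ * K₃ := by
    simp [mul_assoc]
  rw [hcardJ] at i1
  have hN : (Measure.pi fun _ : Fin K₁ × Fin K₂ × Fin K₃ => Qt n v P)
      {C | ∃ j, C j ∈ (powSet n P)ᶜ} = 0 := by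
    rw [Set.ofPred_exists]
    refine measure_iUnion_null fun j => ?_
    have := (measurePreserving_eval (fun _ : Fin K₁ × Fin K₂ × Fin K₃ => Qt n v P) j).measure_preimage
      (powSet_meas n P).compl.nullMeasurableSet
    rw [Qt_powSet] at this
    exact this
  obtain ⟨C, hC, c1, c2, c3⟩ := choose3 _ _ _ _
    (errB_meas (outR n a v) (wd a v) (wd_meas a v) (gErr a v δ) (gErr_meas a v δ) _)
    (lk_meas b₂ v e2) (lk_meas b₁ v e1) _ _ _ (by positivity) (by positivity) (by positivity)
    i1 i2 i3 _ hN
  have hC' : ∀ j, C j ∈ powSet n P := by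
    intro j
    by_contra h
    exact hC ⟨j, h⟩
  obtain ⟨dec, hdec, herr⟩ := err_bound C a v (gErr a v δ)
    (Real.exp (n * (1/2 * Real.log (1 + a * v) - δ))) (Real.exp_pos _)
    (fun x z h => gErr_ge hn a v δ hδ x z h)
  have hfin : ∀ (x B : ℝ) (l : ℝ≥0∞), 0 ≤ B → ENNReal.ofReal x ≤ 1 + l → l ≤ ENNReal.ofReal (3 * B) →
      x ≤ 1 + 3 * B := by
    intro x B l hB h1 h2
    have h3 := h1.trans (add_le_add le_rfl h2)
    rw [← ENNReal.ofReal_one, ← ENNReal.ofReal_add zero_le_one (by positivity)] at h3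
    exact (ENNReal.ofReal_le_ofReal_iff (by positivity)).1 h3
  refine ⟨encC C, encC_prob C, encC_pow C P hC', dec, hdec, ?_, ?_, ?_⟩
  · refine ENNReal.toReal_le_of_le_ofReal (by positivity) (herr.trans c1)
  · refine hfin _ _ _ (by positivity) ?_ c2
    rw [jointLaw_encC C b₂ v]
    exact lk_mi b₂ v e2 C
  · refine hfin _ _ _ (by positivity) ?_ c3
    rw [jointLaw_map C b₁ v]
    exact lk_mi b₁ v e1 C

lemma core (a b₁ b₂ P : ℝ) (v : ℝ≥0) (ha : 0 ≤ a) (hb₁ : 0 ≤ b₁)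
    (hb₂ : 0 ≤ b₂) (hP : 0 < P) (hv : v < P) (r₁ r₂ r₃ δ : ℝ) (hr₁ : 0 ≤ r₁) (hr₂ : 0 ≤ r₂)
    (hr₃ : 0 ≤ r₃) (hδ : 0 < δ) (hsum : r₁ + r₂ + r₃ + 2 * δ ≤ 1/2 * Real.log (1 + a * v))
    (h2 : 1/2 * Real.log (1 + b₂ * v) ≤ r₃) (h1 : 1/2 * Real.log (1 + b₁ * v) ≤ r₂ + r₃)
    (ε : ℝ) (hε : 0 < ε) :
    ∃ n : ℕ, 0 < n ∧ ∃ enc : Fin ⌈Real.exp (n * r₁)⌉₊ × Fin ⌈Real.exp (n * r₂)⌉₊ → Measure (Fin n → ℝ),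
      (∀ m, IsProbabilityMeasure (enc m)) ∧
      (∀ m, enc m {xs | ∑ i, (xs i) ^ 2 ≤ (n : ℝ) * P} = 1) ∧
      ∃ dec : (Fin n → ℝ) → Fin ⌈Real.exp (n * r₁)⌉₊ × Fin ⌈Real.exp (n * r₂)⌉₊, Measurable dec ∧
        (jointLaw a enc {p | dec p.2 ≠ p.1}).toReal ≤ ε ∧
        miBits (jointLaw b₂ enc) ≤ (n : ℝ) * ε ∧
        miBits ((jointLaw b₁ enc).map fun p => (p.1.1, p.2)) ≤ (n : ℝ) * ε := by
  have hl2 := Real.log_pos (by norm_num : (1:ℝ) < 2)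
  have hc0 := cc_pos v P hP hv
  have hVa := Vb_nonneg a v
  have hV1 := Vb_nonneg b₁ v
  have hV2 := Vb_nonneg b₂ v
  set c := cc v P
  set θ : ℝ := ε * Real.log 2 / (6 * c) with hθd
  have hθ : 0 < θ := by positivity
  set Be : ℝ := 3 * (c * (Vb a v / δ^2 + 8 / δ)) / ε with hBe
  set B2 : ℝ := (1 + 3 * (c * (1 + Real.log 2 + Vb b₂ v / θ))) / (ε * Real.log 2 / 2) with hB2
  set B1 : ℝ := (1 + 3 * (c * (1 + Real.log 2 + Vb b₁ v / θ))) / (ε * Real.log 2 / 2) with hB1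
  have pBe : 0 ≤ Be := by positivity
  have pB1 : 0 ≤ B1 := by positivity
  have pB2 : 0 ≤ B2 := by positivity
  obtain ⟨n, hnB⟩ := exists_nat_gt (Be + B1 + B2)
  have hn' : (0:ℝ) < n := by linarith
  have hn : 0 < n := by exact_mod_cast hn'
  have k1 := ceil_exp_pos (n * r₁)
  have k2 := ceil_exp_pos (n * r₂)
  have k3 := ceil_exp_pos (n * r₃)
  have hlog3 := log_ceil_exp (n * r₃)
  have hlog2 := log_ceil_exp (n * r₂)
  have hc1 := ceil_exp_le (n * r₁) (by positivity)
  have hc2 := ceil_exp_le (n * r₂) (by positivity)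
  have hc3 := ceil_exp_le (n * r₃) (by positivity)
  have k2' : (0:ℝ) < ⌈Real.exp (n * r₂)⌉₊ := by exact_mod_cast k2
  have k3' : (0:ℝ) < ⌈Real.exp (n * r₃)⌉₊ := by exact_mod_cast k3
  obtain ⟨enc, e1, e2, dec, hd, herr, hm2, hm1⟩ := code_exists hn a b₁ b₂ P v ha hb₁ hb₂ hP hv
    _ _ _ k1 k2 k3 δ θ hδ hθ (le_trans (mul_le_mul_of_nonneg_left h2 hn'.le) hlog3)
    (by rw [Real.log_mul k2'.ne' k3'.ne']
        have := mul_le_mul_of_nonneg_left h1 hn'.le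
        linarith)
  have hleak : ∀ x V B : ℝ, B = (1 + 3 * (c * (1 + Real.log 2 + V / θ))) / (ε * Real.log 2 / 2) →
      B ≤ n → x * Real.log 2 ≤ 1 + 3 * (c * (1 + Real.log 2 + n * θ + V / θ)) → x ≤ n * ε := by
    intro x V B hB hBn hx
    rw [hB, div_le_iff₀ (by positivity)] at hBn
    have e : 3 * (c * (n * θ)) = n * (ε * Real.log 2 / 2) := by
      rw [hθd]; field_simp; ring
    have : x * Real.log 2 ≤ (n * ε) * Real.log 2 := by
      have e2 : 1 + 3 * (c * (1 + Real.log 2 + n * θ + V / θ)) =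
        (1 + 3 * (c * (1 + Real.log 2 + V / θ))) + 3 * (c * (n * θ)) := by ring
      rw [e2, e] at hx
      linarith
    exact le_of_mul_le_mul_right this hl2
  refine ⟨n, hn, enc, e1, e2, dec, hd, ?_, hleak _ _ _ hB2 (by linarith) hm2,
    hleak _ _ _ hB1 (by linarith) hm1⟩
  refine herr.trans ?_
  have hprod : ((⌈Real.exp (n * r₁)⌉₊ : ℕ) : ℝ) * (⌈Real.exp (n * r₂)⌉₊ : ℕ) * (⌈Real.exp (n * r₃)⌉₊ : ℕ)
      ≤ 8 * Real.exp (n * (r₁ + r₂ + r₃)) := by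
    calc _ ≤ (2 * Real.exp (n * r₁)) * (2 * Real.exp (n * r₂)) * (2 * Real.exp (n * r₃)) := by gcongr
      _ = _ := by
        rw [show n * (r₁ + r₂ + r₃) = n * r₁ + n * r₂ + n * r₃ by ring, Real.exp_add, Real.exp_add]
        ring
  have hexp : Real.exp (-(n * (1/2 * Real.log (1 + a * v) - δ))) *
      (8 * Real.exp (n * (r₁ + r₂ + r₃))) ≤ 8 / (n * δ) := by
    rw [mul_left_comm, ← Real.exp_add]
    have h3 : -(n * (1/2 * Real.log (1 + a * v) - δ)) + n * (r₁ + r₂ + r₃) ≤ -(n * δ) := by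
      have := mul_le_mul_of_nonneg_left hsum hn'.le
      linarith
    have h4 : Real.exp (-(n * δ)) ≤ 1 / (n * δ) := by
      rw [Real.exp_neg, inv_eq_one_div]
      refine one_div_le_one_div_of_le (by positivity) ?_
      linarith [Real.add_one_le_exp (n * δ)]
    calc _ ≤ 8 * (1 / (n * δ)) := by
          refine mul_le_mul_of_nonneg_left ((Real.exp_le_exp.2 h3).trans h4) (by norm_num)
      _ = _ := by ring
  have hBen : Be ≤ n := by linarith
  rw [hBe, div_le_iff₀ hε] at hBen
  calc _ ≤ 3 * (c * (Vb a v / (n * δ^2) + 8 / (n * δ))) := by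
        refine mul_le_mul_of_nonneg_left (mul_le_mul_of_nonneg_left (add_le_add le_rfl ?_) hc0.le)
          (by norm_num)
        exact (mul_le_mul_of_nonneg_left hprod (Real.exp_pos _).le).trans hexp
    _ = 3 * (c * (Vb a v / δ^2 + 8 / δ)) / n := by field_simp
    _ ≤ ε := by rw [div_le_iff₀ hn']; linarith

/-! ### Final assembly -/

lemma half_log_mono (b b' t t' : ℝ) (hb : 0 ≤ b) (hbb : b ≤ b') (ht : 0 ≤ t) (htt : t ≤ t') :
    1/2 * Real.log (1 + b * t) ≤ 1/2 * Real.log (1 + b' * t') := by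
  have h1 : b * t ≤ b' * t' := mul_le_mul hbb htt ht (hb.trans hbb)
  have h2 : 0 ≤ b * t := mul_nonneg hb ht
  have := Real.log_le_log (by linarith) (by linarith : 1 + b * t ≤ 1 + b' * t')
  linarith

lemma Cs_eq (P a b : ℝ) : Cs P a b =
    max 0 ((1/2 * Real.log (1 + a * P) - 1/2 * Real.log (1 + b * P)) / Real.log 2) := by
  unfold Cs Real.logb
  congr 1
  ring

lemma exists_v (a P η : ℝ) (ha : 0 ≤ a) (hP : 0 < P) (hη : 0 < η) :
    ∃ v : ℝ≥0, v < P ∧ 1/2 * Real.log (1 + a * P) - η / 2 ≤ 1/2 * Real.log (1 + a * v) := by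
  have hl : Real.exp (-η) < 1 := by rw [Real.exp_lt_one_iff]; linarith
  have hl0 := Real.exp_pos (-η)
  refine ⟨⟨Real.exp (-η) * P, by positivity⟩, ?_, ?_⟩
  · change Real.exp (-η) * P < P
    nlinarith
  · change _ ≤ 1/2 * Real.log (1 + a * (Real.exp (-η) * P))
    have h1 : Real.exp (-η) * (1 + a * P) ≤ 1 + a * (Real.exp (-η) * P) := by
      nlinarith
    have h2 := Real.log_le_log (by positivity) h1
    rw [Real.log_mul hl0.ne' (by positivity), Real.log_exp] at h2
    linarith

lemma rate_ok (n : ℕ) (R ε r : ℝ) (h : (R - ε) * Real.log 2 ≤ r) :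
    (n : ℝ) * (R - ε) ≤ Real.logb 2 (⌈Real.exp (n * r)⌉₊ : ℕ) := by
  have hl2 := Real.log_pos (by norm_num : (1:ℝ) < 2)
  unfold Real.logb
  rw [le_div_iff₀ hl2]
  refine le_trans ?_ (log_ceil_exp (n * r))
  rw [mul_assoc]
  exact mul_le_mul_of_nonneg_left h (Nat.cast_nonneg n)

lemma achiev_zero (a b₁ b₂ P : ℝ) (hP : 0 ≤ P) : GaussAchievable a b₁ b₂ P 0 0 := by
  intro ε hε
  have hp : ∀ m : Fin 1 × Fin 1, IsProbabilityMeasure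
      ((fun _ => Measure.dirac 0 : Fin 1 × Fin 1 → Measure (Fin 1 → ℝ)) m) :=
    fun m => Measure.dirac.isProbabilityMeasure
  have i1 := jointLaw_prob b₁ _ hp
  have i2 := jointLaw_prob b₂ _ hp
  have hm : Measurable fun p : (Fin 1 × Fin 1) × (Fin 1 → ℝ) => (p.1.1, p.2) := by fun_prop
  have i3 := Measure.isProbabilityMeasure_map (μ := jointLaw b₁ (fun _ => Measure.dirac 0 : Fin 1 × Fin 1 → Measure (Fin 1 → ℝ))) hm.aemeasurable
  refine ⟨1, one_pos, 1, 1, one_pos, one_pos, by simp [hε.le], by simp [hε.le],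
    fun _ => Measure.dirac 0, hp, ?_, fun _ => default, measurable_const, ?_, ?_, ?_⟩
  · intro m
    change Measure.dirac 0 (powSet 1 P) = 1
    rw [Measure.dirac_apply' _ (powSet_meas 1 P)]
    simp [powSet, hP]
  · have : {p : (Fin 1 × Fin 1) × (Fin 1 → ℝ) | (fun _ => default : (Fin 1 → ℝ) → Fin 1 × Fin 1) p.2 ≠ p.1} = ∅ := by
      ext p
      simpa using Subsingleton.elim _ _
    rw [this]
    simp [hε.le]
  · rw [miBits_subsingleton]
    simp [hε.le]
  · rw [miBits_subsingleton]
    simp [hε.le]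

lemma achiev_ii (a b₁ b₂ P : ℝ) (ha : 0 ≤ a) (hb₂ : 0 ≤ b₂) (hP : 0 < P)
    (h : 1/2 * Real.log (1 + b₂ * P) < 1/2 * Real.log (1 + a * P)) :
    GaussAchievable a b₁ b₂ P 0
      ((1/2 * Real.log (1 + a * P) - 1/2 * Real.log (1 + b₂ * P)) / Real.log 2) := by
  intro ε hε
  have hl2 := Real.log_pos (by norm_num : (1:ℝ) < 2)
  set ca := 1/2 * Real.log (1 + a * P) with hca
  set cb := 1/2 * Real.log (1 + b₂ * P) with hcb
  set η := min (ε * Real.log 2) (ca - cb) with hη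
  have hη0 : 0 < η := lt_min (by positivity) (by linarith)
  have hη1 : η ≤ ε * Real.log 2 := min_le_left _ _
  have hη2 : η ≤ ca - cb := min_le_right _ _
  have hcb0 : 0 ≤ cb := by
    have := Real.log_nonneg (by nlinarith [mul_nonneg hb₂ hP.le] : (1:ℝ) ≤ 1 + b₂ * P)
    linarith
  obtain ⟨v, hv, hv2⟩ := exists_v a P η ha hP hη0
  have hbv := half_log_mono b₂ b₂ v P hb₂ le_rfl v.2 hv.le
  obtain ⟨n, hn, enc, hp, hpow, dec, hdec, herr, hm2, -⟩ := core a b₂ b₂ P v ha hb₂ hb₂ hP hv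
    0 (ca - cb - η) cb (η / 4) le_rfl (by linarith) hcb0 (by linarith) (by linarith) hbv (by linarith) ε hε
  have hK : ⌈Real.exp (n * 0)⌉₊ = 1 := by simp
  have hsub : Subsingleton (Fin ⌈Real.exp ((n : ℝ) * 0)⌉₊) := by rw [hK]; infer_instance
  have n1 : Nonempty (Fin ⌈Real.exp ((n : ℝ) * 0)⌉₊) := ⟨⟨0, ceil_exp_pos _⟩⟩
  have n2 : Nonempty (Fin ⌈Real.exp (n * (ca - cb - η))⌉₊) := ⟨⟨0, ceil_exp_pos _⟩⟩
  refine ⟨n, hn, _, _, ceil_exp_pos _, ceil_exp_pos _, rate_ok n _ _ _ ?_, rate_ok n _ _ _ ?_,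
    enc, hp, hpow, dec, hdec, herr, hm2, ?_⟩
  · nlinarith
  · rw [sub_mul, div_mul_cancel₀ _ hl2.ne']
    linarith
  · have i1 := jointLaw_prob b₁ _ hp
    have hm : Measurable fun p : (Fin ⌈Real.exp ((n : ℝ) * 0)⌉₊ × Fin ⌈Real.exp (n * (ca - cb - η))⌉₊)
      × (Fin n → ℝ) => (p.1.1, p.2) := by fun_prop
    have i3 := Measure.isProbabilityMeasure_map (μ := jointLaw b₁ enc) hm.aemeasurable
    rw [miBits_subsingleton]
    positivity

lemma achiev_iii (a b₁ b₂ P : ℝ) (ha : 0 ≤ a) (hb₁₂ : b₂ ≤ b₁) (hb₂ : 0 ≤ b₂) (hP : 0 < P)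
    (h : 1/2 * Real.log (1 + b₁ * P) < 1/2 * Real.log (1 + a * P)) :
    GaussAchievable a b₁ b₂ P
      ((1/2 * Real.log (1 + a * P) - 1/2 * Real.log (1 + b₁ * P)) / Real.log 2)
      ((1/2 * Real.log (1 + b₁ * P) - 1/2 * Real.log (1 + b₂ * P)) / Real.log 2) := by
  intro ε hε
  have hl2 := Real.log_pos (by norm_num : (1:ℝ) < 2)
  have hcc := half_log_mono b₂ b₁ P P hb₂ hb₁₂ hP.le le_rfl
  set ca := 1/2 * Real.log (1 + a * P) with hca
  set cb := 1/2 * Real.log (1 + b₂ * P) with hcb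
  set cb1 := 1/2 * Real.log (1 + b₁ * P) with hcb1
  set η := min (ε * Real.log 2) (ca - cb1) with hη
  have hη0 : 0 < η := lt_min (by positivity) (by linarith)
  have hη1 : η ≤ ε * Real.log 2 := min_le_left _ _
  have hη2 : η ≤ ca - cb1 := min_le_right _ _
  have hcb0 : 0 ≤ cb := by
    have := Real.log_nonneg (by nlinarith [mul_nonneg hb₂ hP.le] : (1:ℝ) ≤ 1 + b₂ * P)
    linarith
  obtain ⟨v, hv, hv2⟩ := exists_v a P η ha hP hη0
  have hbv := half_log_mono b₂ b₂ v P hb₂ le_rfl v.2 hv.le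
  have hbv1 := half_log_mono b₁ b₁ v P (hb₂.trans hb₁₂) le_rfl v.2 hv.le
  obtain ⟨n, hn, enc, hp, hpow, dec, hdec, herr, hm2, hm1⟩ := core a b₁ b₂ P v ha (hb₂.trans hb₁₂) hb₂ hP hv
    (ca - cb1 - η) (cb1 - cb) cb (η / 4) (by linarith) (by linarith) hcb0 (by linarith) (by linarith)
    hbv (by linarith) ε hε
  refine ⟨n, hn, _, _, ceil_exp_pos _, ceil_exp_pos _, rate_ok n _ _ _ ?_, rate_ok n _ _ _ ?_,
    enc, hp, hpow, dec, hdec, herr, hm2, hm1⟩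
  · rw [sub_mul, div_mul_cancel₀ _ hl2.ne']
    linarith
  · rw [sub_mul, div_mul_cancel₀ _ hl2.ne']
    nlinarith

/-- the corner point `(Cs(P,a,b₁), Cs(P,a,b₂) − Cs(P,a,b₁))` is achievable
for the scalar Gaussian two-level security wiretap channel; hence scalar Gaussian
two-level security wiretap channels under an average power constraint are perfectly
embeddable: the high-security message is communicated at full rate `Cs(P,a,b₁)` (the
secrecy capacity of the wiretap channel to `Z₁`) while the sum rate equals `Cs(P,a,b₂)`
(the secrecy capacity of the wiretap channel to `Z₂`). -/
theorem stmt7_gaussian_perfectly_embeddable (a b₁ b₂ P : ℝ)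
    (ha : 0 ≤ a) (hb₁₂ : b₁ ≥ b₂) (hb₂ : b₂ ≥ 0) (hP : 0 ≤ P) :
    Cs P a b₁ ≤ Cs P a b₂ ∧
    GaussAchievable a b₁ b₂ P (Cs P a b₁) (Cs P a b₂ - Cs P a b₁) := by
  have hl2 := Real.log_pos (by norm_num : (1:ℝ) < 2)
  have hcc := half_log_mono b₂ b₁ P P hb₂ hb₁₂ hP le_rfl
  rw [Cs_eq, Cs_eq]
  refine ⟨max_le_max le_rfl (div_le_div_of_nonneg_right (by linarith) hl2.le), ?_⟩
  by_cases h2 : 1/2 * Real.log (1 + a * P) ≤ 1/2 * Real.log (1 + b₂ * P)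
  · rw [max_eq_left (div_nonpos_of_nonpos_of_nonneg (by linarith) hl2.le),
      max_eq_left (div_nonpos_of_nonpos_of_nonneg (by linarith) hl2.le), sub_zero]
    exact achiev_zero a b₁ b₂ P hP
  · have hP' : 0 < P := by
      rcases hP.lt_or_eq with h | h
      · exact h
      · exact absurd (by simp [← h]) h2
    push Not at h2
    rw [max_eq_right (div_nonneg (by linarith) hl2.le : 0 ≤
      (1/2 * Real.log (1 + a * P) - 1/2 * Real.log (1 + b₂ * P)) / Real.log 2)]
    by_cases h1 : 1/2 * Real.log (1 + a * P) ≤ 1/2 * Real.log (1 + b₁ * P)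
    · rw [max_eq_left (div_nonpos_of_nonpos_of_nonneg (by linarith) hl2.le), sub_zero]
      exact achiev_ii a b₁ b₂ P ha hb₂ hP' h2
    · push Not at h1
      rw [max_eq_right (div_nonneg (by linarith) hl2.le), ← sub_div, sub_sub_sub_cancel_left]
      exact achiev_iii a b₁ b₂ P ha hb₁₂ hb₂ hP' h1
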